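/- arXiv:1109.5300 — 6 statements merged into one kernel-verified Lean document; each statement's English description precedes it below -/
import Mathlib

section
/- Let n be a positive even integer, let 1 ≤ m < n and let t be an integer with |t| < n. Then the isometry group of M_n acts transitively on the set Θ_t^m of (t,m)-pairs: for any two (t,m)-pairs {x,y} and {u,v} in M_n there is a surjective isometry φ of M_n with {φ(x),φ(y)} = {u,v}. -/
/-!
For a positive even integer `n`, `Ln n = {k·n^{-n} : 1 ≤ k ≤ n^{2n}}` carries the cyclic
metric `χ(a,b) = min{|a−b|, n^n − |a−b|}`, and `Mn n` is the product of `n^n` copies of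
`Ln n` with the supremum metric `supDist`.  A `(t,m)`-pair is an (unordered) pair
`{x,y} ⊆ Mn n` with `χ(x_i,y_i) = 2^t` whenever `x_i ≠ y_i` and with exactly `n^m`
differing coordinates.
-/

/-- The cyclic metric with period `n^n`. -/
noncomputable def cyclicDist (n : ℕ) (a b : ℝ) : ℝ :=
  min |a - b| ((n : ℝ) ^ n - |a - b|)

/-- The set `L_n = {k·n^{-n} : 1 ≤ k ≤ n^{2n}}`. -/
def Ln (n : ℕ) : Set ℝ :=
  {a | ∃ k : ℕ, 1 ≤ k ∧ k ≤ n ^ (2 * n) ∧ a = (k : ℝ) / (n : ℝ) ^ n}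

/-- The set `M_n`, the product of `n^n` copies of `L_n`. -/
def Mn (n : ℕ) : Set (Fin (n ^ n) → ℝ) := {x | ∀ i, x i ∈ Ln n}

/-- The supremum metric on `M_n`. -/
noncomputable def supDist (n : ℕ) (x y : Fin (n ^ n) → ℝ) : ℝ :=
  ⨆ i, cyclicDist n (x i) (y i)

/-- `{x, y}` is a `(t,m)`-pair in `M_n`. -/
def IsPair (n : ℕ) (t : ℤ) (m : ℕ) (x y : Fin (n ^ n) → ℝ) : Prop :=
  x ∈ Mn n ∧ y ∈ Mn n ∧
    (∀ i, x i ≠ y i → cyclicDist n (x i) (y i) = (2 : ℝ) ^ t) ∧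
    Set.ncard {i | x i ≠ y i} = n ^ m

/-- `Ln n` consists of the points of `(0, n^n]` on the grid of mesh `n^{-n}`. -/
lemma mem_Ln_iff {n : ℕ} (hn : 0 < n) {a : ℝ} :
    a ∈ Ln n ↔ a ∈ Set.Ioc (0 : ℝ) ((n : ℝ) ^ n) ∧ ∃ k : ℤ, a * (n : ℝ) ^ n = k := by
  have hP : (0 : ℝ) < (n : ℝ) ^ n := by positivity
  constructor
  · rintro ⟨k, hk1, hk2, rfl⟩
    have h1 : (1 : ℝ) ≤ k := by exact_mod_cast hk1
    have h2 : (k : ℝ) ≤ (n : ℝ) ^ (2 * n) := by exact_mod_cast hk2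
    refine ⟨⟨by positivity, ?_⟩, k, by simp [hP.ne']⟩
    rw [div_le_iff₀ hP, ← pow_add, ← two_mul]
    exact h2
  · rintro ⟨⟨h0, h1⟩, k, hk⟩
    have hk0 : 0 < k := by
      have : (0 : ℝ) < k := hk ▸ mul_pos h0 hP
      exact_mod_cast this
    lift k to ℕ using hk0.le
    refine ⟨k, by omega, ?_, by rw [eq_div_iff hP.ne', hk]; simp⟩
    have : (k : ℝ) ≤ (n : ℝ) ^ (2 * n) := by
      rw [two_mul, pow_add]
      have := mul_le_mul_of_nonneg_right h1 hP.le
      rw [hk] at this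
      simpa using this
    exact_mod_cast this

lemma finite_Ln (n : ℕ) : (Ln n).Finite := by
  refine ((Set.finite_Icc 1 (n ^ (2 * n))).image fun k : ℕ => (k : ℝ) / (n : ℝ) ^ n).subset ?_
  rintro _ ⟨k, h1, h2, rfl⟩
  exact ⟨k, ⟨h1, h2⟩, rfl⟩

/-- The cyclic distance of points of `(0, n^n]` depends only on their difference modulo `n^n`. -/
lemma cyclicDist_eq_of_sub_eq {n : ℕ} {a b c d : ℝ}
    (ha : a ∈ Set.Ioc (0 : ℝ) ((n : ℝ) ^ n)) (hb : b ∈ Set.Ioc (0 : ℝ) ((n : ℝ) ^ n))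
    (hc : c ∈ Set.Ioc (0 : ℝ) ((n : ℝ) ^ n)) (hd : d ∈ Set.Ioc (0 : ℝ) ((n : ℝ) ^ n))
    {k : ℤ} (h : a - b = c - d + k * (n : ℝ) ^ n) :
    cyclicDist n a b = cyclicDist n c d := by
  unfold cyclicDist
  generalize (n : ℝ) ^ n = P at *
  obtain ⟨ha0, ha1⟩ := ha
  obtain ⟨hb0, hb1⟩ := hb
  obtain ⟨hc0, hc1⟩ := hc
  obtain ⟨hd0, hd1⟩ := hd
  have hP : 0 < P := by linarith
  have hk2 : k < 2 := by
    have : (k : ℝ) < 2 := by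
      by_contra! hk
      nlinarith
    exact_mod_cast this
  have hk1 : -2 < k := by
    have : (-2 : ℝ) < k := by
      by_contra! hk
      nlinarith
    exact_mod_cast this
  obtain rfl | rfl | rfl : k = -1 ∨ k = 0 ∨ k = 1 := by omega
  · have h1 : |c - d| = c - d := abs_of_nonneg (by push_cast at h; linarith)
    have h2 : |a - b| = -(a - b) := abs_of_nonpos (by push_cast at h; linarith)
    rw [h1, h2, h, min_comm]
    push_cast
    congr 1 <;> ring
  · simp [h]
  · have h1 : |c - d| = -(c - d) := abs_of_nonpos (by push_cast at h; linarith)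
    have h2 : |a - b| = a - b := abs_of_nonneg (by push_cast at h; linarith)
    rw [h1, h2, h, min_comm]
    push_cast
    congr 1 <;> ring

lemma cyclicDist_comm (n : ℕ) (a b : ℝ) : cyclicDist n a b = cyclicDist n b a := by
  simp [cyclicDist, abs_sub_comm]

/-- Pairs of equal cyclic distance have, up to sign, equal differences modulo `n^n`. -/
lemma exists_sign_sub_eq_of_cyclicDist_eq {n : ℕ} {a b c d : ℝ}
    (h : cyclicDist n a b = cyclicDist n c d) :
    ∃ s : ℝ, (s = 1 ∨ s = -1) ∧ ∃ k : ℤ, d - c = s * (b - a) + k * (n : ℝ) ^ n := by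
  unfold cyclicDist at h
  generalize (n : ℝ) ^ n = P at *
  have key : |a - b| = |c - d| ∨ |a - b| = P - |c - d| := by
    rcases min_choice |a - b| (P - |a - b|) with h1 | h1 <;>
    rcases min_choice |c - d| (P - |c - d|) with h2 | h2 <;>
    rw [h1, h2] at h
    · exact .inl h
    · exact .inr h
    · exact .inr (by linarith)
    · exact .inl (by linarith)
  rcases abs_choice (a - b) with h1 | h1 <;> rcases abs_choice (c - d) with h2 | h2 <;>
    rw [h1, h2] at key <;> rcases key with key | key
  · exact ⟨1, .inl rfl, 0, by push_cast; linarith⟩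
  · exact ⟨-1, .inr rfl, -1, by push_cast; linarith⟩
  · exact ⟨-1, .inr rfl, 0, by push_cast; linarith⟩
  · exact ⟨1, .inl rfl, 1, by push_cast; linarith⟩
  · exact ⟨-1, .inr rfl, 0, by push_cast; linarith⟩
  · exact ⟨1, .inl rfl, -1, by push_cast; linarith⟩
  · exact ⟨1, .inl rfl, 0, by push_cast; linarith⟩
  · exact ⟨-1, .inr rfl, 1, by push_cast; linarith⟩

lemma cyclicDist_eq_zero_iff {n : ℕ} {a b : ℝ}
    (ha : a ∈ Set.Ioc (0 : ℝ) ((n : ℝ) ^ n)) (hb : b ∈ Set.Ioc (0 : ℝ) ((n : ℝ) ^ n)) :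
    cyclicDist n a b = 0 ↔ a = b := by
  unfold cyclicDist
  obtain ⟨ha0, ha1⟩ := ha
  obtain ⟨hb0, hb1⟩ := hb
  have hlt : |a - b| < (n : ℝ) ^ n := abs_lt.2 ⟨by linarith, by linarith⟩
  constructor
  · intro h
    rcases min_choice |a - b| ((n : ℝ) ^ n - |a - b|) with h1 | h1
    · rw [h1, abs_eq_zero] at h
      linarith
    · rw [h1] at h
      linarith
  · rintro rfl
    simp only [sub_self, abs_zero, sub_zero]
    exact min_eq_left (by linarith)

/-- The isometry group of `Ln n` acts transitively on ordered pairs at a given distance. -/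
lemma exists_isometry_Ln {n : ℕ} (hn : 0 < n) {a b c d : ℝ}
    (ha : a ∈ Ln n) (hc : c ∈ Ln n) (hd : d ∈ Ln n)
    (h : cyclicDist n a b = cyclicDist n c d) :
    ∃ f : ℝ → ℝ, Set.BijOn f (Ln n) (Ln n) ∧
      (∀ z ∈ Ln n, ∀ w ∈ Ln n, cyclicDist n (f z) (f w) = cyclicDist n z w) ∧
      f a = c ∧ f b = d := by
  have hP : (0 : ℝ) < (n : ℝ) ^ n := by positivity
  obtain ⟨s, hs, k, hk⟩ := exists_sign_sub_eq_of_cyclicDist_eq h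
  have hmod (z : ℝ) : ∃ j : ℤ, toIocMod hP 0 z = z - j * (n : ℝ) ^ n :=
    ⟨toIocDiv hP 0 z, by rw [toIocMod, zsmul_eq_mul]⟩
  have hIoc (z : ℝ) : toIocMod hP 0 z ∈ Set.Ioc (0 : ℝ) ((n : ℝ) ^ n) := by
    simpa using toIocMod_mem_Ioc hP 0 z
  have hfix {z : ℝ} (hz : z ∈ Ln n) : toIocMod hP 0 z = z :=
    (toIocMod_eq_self hP).2 (by simpa using ((mem_Ln_iff hn).1 hz).1)
  let f : ℝ → ℝ := fun z => toIocMod hP 0 (c + s * (z - a))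
  have hmaps : Set.MapsTo f (Ln n) (Ln n) := by
    intro z hz
    refine (mem_Ln_iff hn).2 ⟨hIoc _, ?_⟩
    obtain ⟨j, hj⟩ := hmod (c + s * (z - a))
    obtain ⟨-, kz, hkz⟩ := (mem_Ln_iff hn).1 hz
    obtain ⟨-, ka, hka⟩ := (mem_Ln_iff hn).1 ha
    obtain ⟨-, kc, hkc⟩ := (mem_Ln_iff hn).1 hc
    simp only [f, hj]
    rcases hs with rfl | rfl
    · refine ⟨kc + (kz - ka) - j * n ^ n * n ^ n, ?_⟩
      push_cast
      rw [← hkz, ← hka, ← hkc]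
      ring
    · refine ⟨kc - (kz - ka) - j * n ^ n * n ^ n, ?_⟩
      push_cast
      rw [← hkz, ← hka, ← hkc]
      ring
  have hiso : ∀ z ∈ Ln n, ∀ w ∈ Ln n, cyclicDist n (f z) (f w) = cyclicDist n z w := by
    intro z hz w hw
    have hz' := ((mem_Ln_iff hn).1 hz).1
    have hw' := ((mem_Ln_iff hn).1 hw).1
    obtain ⟨i, hi⟩ := hmod (c + s * (z - a))
    obtain ⟨j, hj⟩ := hmod (c + s * (w - a))
    rcases hs with rfl | rfl
    · refine cyclicDist_eq_of_sub_eq (hIoc _) (hIoc _) hz' hw' (k := j - i) ?_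
      simp only [f, hi, hj]
      push_cast
      ring
    · rw [cyclicDist_comm n z w]
      refine cyclicDist_eq_of_sub_eq (hIoc _) (hIoc _) hw' hz' (k := j - i) ?_
      simp only [f, hi, hj]
      push_cast
      ring
  have hinj : Set.InjOn f (Ln n) := by
    intro z hz w hw hzw
    rw [← cyclicDist_eq_zero_iff ((mem_Ln_iff hn).1 hz).1 ((mem_Ln_iff hn).1 hw).1,
      ← hiso z hz w hw, cyclicDist_eq_zero_iff (hIoc _) (hIoc _)]
    exact hzw
  refine ⟨f, ((finite_Ln n).injOn_iff_bijOn_of_mapsTo hmaps).1 hinj, hiso, ?_, ?_⟩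
  · simpa [f] using hfix hc
  · have : c + s * (b - a) = d + (-k) • (n : ℝ) ^ n := by
      rw [zsmul_eq_mul]
      push_cast
      linarith
    simp only [f]
    rw [this, toIocMod_add_zsmul, hfix hd]

/-- Two subsets of a finite type with equally many elements are related by a permutation. -/
lemma exists_perm_mem_iff {ι : Type*} [Finite ι] {s t : Set ι} (h : s.ncard = t.ncard) :
    ∃ σ : Equiv.Perm ι, ∀ i, σ i ∈ t ↔ i ∈ s := by
  classical
  have := Fintype.ofFinite ι
  have e : {i // i ∈ s} ≃ {i // i ∈ t} := Fintype.equivOfCardEq <| by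
    simpa only [← Nat.card_eq_fintype_card, ← Nat.card_coe_set_eq] using h
  refine ⟨e.extendSubtype, fun i => ?_⟩
  by_cases hi : i ∈ s
  · simp [hi, e.extendSubtype_mem i hi]
  · simp [hi, e.extendSubtype_not_mem i hi]

/-- A coordinate permutation combined with isometries of the factors is an isometry of `Mn n`. -/
lemma bijOn_and_supDist_eq {n : ℕ} (σ : Equiv.Perm (Fin (n ^ n)))
    {F : Fin (n ^ n) → ℝ → ℝ} (hbij : ∀ i, Set.BijOn (F i) (Ln n) (Ln n))
    (hiso : ∀ i, ∀ z ∈ Ln n, ∀ w ∈ Ln n, cyclicDist n (F i z) (F i w) = cyclicDist n z w) :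
    Set.BijOn (fun z j => F j (z (σ j))) (Mn n) (Mn n) ∧
      ∀ a ∈ Mn n, ∀ b ∈ Mn n,
        supDist n (fun j => F j (a (σ j))) (fun j => F j (b (σ j))) = supDist n a b := by
  refine ⟨⟨fun z hz j => (hbij j).mapsTo (hz _), ?_, ?_⟩, ?_⟩
  · intro z hz w hw h
    funext i
    have := congrFun h (σ.symm i)
    simp only [Equiv.apply_symm_apply] at this
    exact (hbij _).injOn (hz i) (hw i) this
  · intro w hw
    choose g hg hFg using fun j => (hbij j).surjOn (hw j)
    refine ⟨fun i => g (σ.symm i), fun i => hg _, ?_⟩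
    funext j
    simp [hFg]
  · intro a ha b hb
    unfold supDist
    rw [← σ.iSup_comp (g := fun i => cyclicDist n (a i) (b i))]
    exact iSup_congr fun j => hiso j _ (ha _) _ (hb _)

/-- Lemma 2 of the paper: for a positive even integer `n`, `1 ≤ m < n`
and `|t| < n`, the isometry group of `M_n` acts transitively on the set `Θ_t^m` of
`(t,m)`-pairs: for any two `(t,m)`-pairs `{x,y}` and `{u,v}` there is a surjective
isometry `φ` of `M_n` with `{φ(x),φ(y)} = {u,v}`. -/
theorem isometry_group_transitive_on_pairs (n : ℕ) (hn : 0 < n) (hne : Even n)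
    (m : ℕ) (hm : 1 ≤ m) (hmn : m < n) (t : ℤ) (ht : |t| < (n : ℤ))
    (x y u v : Fin (n ^ n) → ℝ) (hxy : IsPair n t m x y) (huv : IsPair n t m u v) :
    ∃ φ : (Fin (n ^ n) → ℝ) → (Fin (n ^ n) → ℝ),
      Set.BijOn φ (Mn n) (Mn n) ∧
      (∀ a ∈ Mn n, ∀ b ∈ Mn n, supDist n (φ a) (φ b) = supDist n a b) ∧
      ((φ x = u ∧ φ y = v) ∨ (φ x = v ∧ φ y = u)) := by
  obtain ⟨hx, -, hxy, hxyc⟩ := hxy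
  obtain ⟨hu, hv, huv, huvc⟩ := huv
  obtain ⟨σ, hσ⟩ := exists_perm_mem_iff (huvc.trans hxyc.symm)
  have hdist (j) : cyclicDist n (x (σ j)) (y (σ j)) = cyclicDist n (u j) (v j) := by
    have hj : x (σ j) ≠ y (σ j) ↔ u j ≠ v j := hσ j
    by_cases h : u j = v j
    · have h' : x (σ j) = y (σ j) := by
        by_contra h'
        exact hj.1 h' h
      simp [cyclicDist, h, h']
    · rw [huv j h, hxy _ (hj.2 h)]
  choose F hbij hiso hFx hFy using fun j =>
    exists_isometry_Ln hn (hx (σ j)) (hu j) (hv j) (hdist j)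
  obtain ⟨hφ, hφiso⟩ := bijOn_and_supDist_eq σ hbij hiso
  exact ⟨_, hφ, hφiso, .inl ⟨funext hFx, funext hFy⟩⟩
end

section
/- The locally finite metric space (𝔷,ζ) does not coarsely embed into any metric space of non zero generalized roundness: if (B,d) is a metric space with 𝔮(B) > 0 (including 𝔮(B) = ∞), then there is no coarse embedding f : 𝔷 → B. -/
/-- A copy of `M_n` (the product of `n^n` copies of `L_n`) realized as functions
`ℕ → ℝ` supported on the first `n^n` coordinates. -/
def MnF (n : ℕ) : Set (ℕ → ℝ) :=
  {x | (∀ i, i < n ^ n → x i ∈ Ln n) ∧ ∀ i, n ^ n ≤ i → x i = 0}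

/-- The supremum metric on `MnF n`. -/
noncomputable def supDistF (n : ℕ) (x y : ℕ → ℝ) : ℝ :=
  ⨆ i : Fin (n ^ n), cyclicDist n (x i) (y i)

/-- The underlying set of the space `𝔷`: the disjoint union of the spaces `M_n`
over all (positive) even `n`, a point of `M_n` being recorded as a tag `n` together
with a point of `MnF n`. -/
def ZSpace : Set (ℕ × (ℕ → ℝ)) :=
  {z | 0 < z.1 ∧ Even z.1 ∧ z.2 ∈ MnF z.1}

/-- The metric `ζ` on `𝔷`: it restricts to the supremum metric on each `M_n`, and
`ζ(x,y) = 4^{m+n}` if `x ∈ M_m`, `y ∈ M_n` with `m ≠ n`. -/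
noncomputable def zeta (a b : ℕ × (ℕ → ℝ)) : ℝ :=
  if a.1 = b.1 then supDistF a.1 a.2 b.2 else 4 ^ (a.1 + b.1)

/-- The distance function of the metric space `(𝔷, ζ)`. -/
noncomputable def zetaDist (a b : ZSpace) : ℝ := zeta a.1 b.1

/-- The set of exponents `p ≥ 0` for which the generalized roundness inequality holds in
the space with distance function `d`. -/
def grSet {X : Type*} (d : X → X → ℝ) : Set ℝ :=
  {p | 0 ≤ p ∧ ∀ n : ℕ, 2 ≤ n → ∀ x y : Fin n → X,
    (∑ i, ∑ j, if i < j then d (x i) (x j) ^ p + d (y i) (y j) ^ p else 0) ≤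
      ∑ i, ∑ j, d (x i) (y j) ^ p}

/-- The generalized roundness `𝔮` of the space with distance function `d`,
valued in `ℝ≥0∞`. -/
noncomputable def genRoundness {X : Type*} (d : X → X → ℝ) : ENNReal :=
  sSup (ENNReal.ofReal '' grSet d)
/-- `f` is a coarse embedding of the space with distance function `dX` into the space
with distance function `dY`: there are non-decreasing `ρ₁, ρ₂` with
`ρ₁(dX a b) ≤ dY (f a) (f b) ≤ ρ₂(dX a b)` and `ρ₁(t) → ∞` as `t → ∞`. -/
def IsCoarseEmbeddingWith {X Y : Type*} (dX : X → X → ℝ) (dY : Y → Y → ℝ)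
    (f : X → Y) : Prop :=
  ∃ ρ₁ ρ₂ : ℝ → ℝ, Monotone ρ₁ ∧ Monotone ρ₂ ∧
    (∀ a b, ρ₁ (dX a b) ≤ dY (f a) (f b) ∧ dY (f a) (f b) ≤ ρ₂ (dX a b)) ∧
    Filter.Tendsto ρ₁ Filter.atTop Filter.atTop

/-- `f` is a uniform embedding of the space with distance function `dX` into the space
with distance function `dY`: `f` is injective and both `f` and `f⁻¹` (on the range of
`f`) are uniformly continuous. -/
def IsUniformEmbeddingWith {X Y : Type*} (dX : X → X → ℝ) (dY : Y → Y → ℝ)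
    (f : X → Y) : Prop :=
  Function.Injective f ∧
    (∀ ε : ℝ, 0 < ε → ∃ δ : ℝ, 0 < δ ∧ ∀ a b, dX a b < δ → dY (f a) (f b) < ε) ∧
    (∀ ε : ℝ, 0 < ε → ∃ δ : ℝ, 0 < δ ∧ ∀ a b, dY (f a) (f b) < δ → dX a b < ε)

section Roundness

variable {B : Type*} [MetricSpace B]

/-- In the double sums of a positive power of the metric the diagonal vanishes, so membership
in `grSet` yields the inequality between full double sums, over any finite index type. -/
lemma sum_dist_rpow_le {p : ℝ} (hp : 0 < p) (h : p ∈ grSet (dist : B → B → ℝ))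
    {I : Type*} [Fintype I] (x y : I → B) :
    ∑ i, ∑ j, (dist (x i) (x j) ^ p + dist (y i) (y j) ^ p) ≤
      2 * ∑ i, ∑ j, dist (x i) (y j) ^ p := by
  have key : ∀ (n : ℕ) (x y : Fin n → B),
      ∑ i, ∑ j, (dist (x i) (x j) ^ p + dist (y i) (y j) ^ p) ≤
        2 * ∑ i, ∑ j, dist (x i) (y j) ^ p := by
    intro n x y
    rcases lt_or_ge n 2 with hn | hn
    · interval_cases n
      · simp
      · simp only [Finset.univ_unique, Finset.sum_singleton, dist_self,
          Real.zero_rpow hp.ne', add_zero]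
        positivity
    · set u : Fin n → Fin n → ℝ := fun i j => dist (x i) (x j) ^ p + dist (y i) (y j) ^ p with hu
      have split : ∀ i j, u i j = (if i < j then u i j else 0) + (if j < i then u j i else 0) := by
        intro i j
        rcases lt_trichotomy i j with hij | hij | hij
        · simp [hij, hij.not_gt]
        · subst hij
          simp [hu, Real.zero_rpow hp.ne']
        · simp [hij, hij.not_gt, hu, dist_comm]
      have swap : ∑ i, ∑ j, (if j < i then u j i else 0) = ∑ i, ∑ j, if i < j then u i j else 0 :=
        Finset.sum_comm
      calc ∑ i, ∑ j, u i j
          = ∑ i, ∑ j, ((if i < j then u i j else 0) + (if j < i then u j i else 0)) :=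
            Finset.sum_congr rfl fun i _ => Finset.sum_congr rfl fun j _ => split i j
        _ = 2 * ∑ i, ∑ j, if i < j then u i j else 0 := by
            simp only [Finset.sum_add_distrib]
            rw [swap, two_mul]
        _ ≤ _ := by
            have := h.2 n hn x y
            gcongr
  let e := (Fintype.equivFin I).symm
  have := key _ (x ∘ e) (y ∘ e)
  have tr : ∀ k : I → I → ℝ, ∑ i, ∑ j, k (e i) (e j) = ∑ i, ∑ j, k i j := by
    intro k
    rw [← e.sum_comp]
    exact Finset.sum_congr rfl fun i _ => e.sum_comp _
  simp only [Function.comp_apply] at this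
  rwa [tr fun i j => dist (x i) (x j) ^ p + dist (y i) (y j) ^ p,
    tr fun i j => dist (x i) (y j) ^ p] at this

/-- An equal-weight form of conditional negative definiteness for a function on a group. -/
def IsNegType {V : Type*} [Sub V] (φ : V → ℝ) : Prop :=
  ∀ (I : Type) [Fintype I] (x y : I → V),
    ∑ i, ∑ j, (φ (x i - x j) + φ (y i - y j)) ≤ 2 * ∑ i, ∑ j, φ (x i - y j)

lemma isNegType_sum_dist_rpow {p : ℝ} (hp : 0 < p) (h : p ∈ grSet (dist : B → B → ℝ))
    {V G : Type*} [AddGroup V] [AddCommGroup G] [Fintype G] (θ : V →+ G) (F : G → B) :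
    IsNegType fun v => ∑ g, dist (F (g + θ v)) (F g) ^ p := by
  intro I _ x y
  have shift : ∀ a b : V, ∑ g, dist (F (g + θ (a - b))) (F g) ^ p =
      ∑ g, dist (F (g + θ a)) (F (g + θ b)) ^ p := by
    intro a b
    refine (Equiv.sum_comp (Equiv.addRight (θ b))
      fun g => dist (F (g + θ (a - b))) (F g) ^ p).symm.trans ?_
    simp [add_assoc]
  have swap : ∀ k : G → I → I → ℝ, ∑ i, ∑ j, ∑ g, k g i j = ∑ g, ∑ i, ∑ j, k g i j := by
    intro k
    rw [Finset.sum_comm]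
    conv_lhs => enter [2, j]; rw [Finset.sum_comm]
    rw [Finset.sum_comm]
    exact Finset.sum_congr rfl fun g _ => Finset.sum_comm
  simp only [shift, ← Finset.sum_add_distrib]
  rw [swap, swap, Finset.mul_sum]
  exact Finset.sum_le_sum fun g _ => sum_dist_rpow_le hp h (fun i => F (g + θ (x i))) _

end Roundness

section RandomDisplacement

variable {ι Ω : Type} [Fintype ι] [DecidableEq ι] [Fintype Ω]

/-- Exchange the coordinates outside `S` of a pair of functions, applying `σ` to the ones that
move to the first function. -/
def mixEquiv (σ : Equiv.Perm Ω) (S : ι → Bool) : (ι → Ω) × (ι → Ω) ≃ (ι → Ω) × (ι → Ω) where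
  toFun c := (fun i => if S i then c.1 i else σ (c.2 i), fun i => if S i then c.2 i else c.1 i)
  invFun c := (fun i => if S i then c.1 i else c.2 i,
    fun i => if S i then c.2 i else σ.symm (c.1 i))
  left_inv c := by
    ext i <;> dsimp only <;> split_ifs <;> simp
  right_inv c := by
    ext i <;> dsimp only <;> split_ifs <;> simp

/-- The difference of two independent copies of `u`, killed with probability one half. -/
def lazyDiff (u : Ω → ℤ) : Bool × Ω × Ω → ℤ := fun c => if c.1 then u c.2.1 - u c.2.2 else 0

lemma sum_lazyDiff_le {φ : (ι → ℤ) → ℝ} (hφ : IsNegType φ) (u : Ω → ℤ) (σ : Equiv.Perm Ω)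
    (hσ : ∀ a, u (σ a) = -u a) :
    ∑ c : ι → Bool × Ω × Ω, φ (lazyDiff u ∘ c) ≤
      2 ^ Fintype.card ι * Fintype.card Ω ^ Fintype.card ι * ∑ c : ι → Ω, φ (u ∘ c) := by
  classical
  let D : (ι → Bool) → (ι → Ω) → (ι → Ω) → ℝ :=
    fun S a b => φ fun i => if S i then u (a i) - u (b i) else 0
  have lhs : ∑ c : ι → Bool × Ω × Ω, φ (lazyDiff u ∘ c) =
      ∑ S : ι → Bool, ∑ a : ι → Ω, ∑ b : ι → Ω, D S a b := by
    let e : (ι → Bool × Ω × Ω) ≃ (ι → Bool) × (ι → Ω) × (ι → Ω) :=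
      (Equiv.arrowProdEquivProdArrow ι _ _).trans
        ((Equiv.refl _).prodCongr (Equiv.arrowProdEquivProdArrow ι _ _))
    rw [← e.symm.sum_comp, Fintype.sum_prod_type]
    refine Finset.sum_congr rfl fun S _ => ?_
    rw [Fintype.sum_prod_type]
    rfl
  have compl : ∑ S : ι → Bool, ∑ a : ι → Ω, ∑ b : ι → Ω, D (fun i => !S i) a b =
      ∑ S : ι → Bool, ∑ a : ι → Ω, ∑ b : ι → Ω, D S a b :=
    Equiv.sum_comp ((Equiv.refl ι).arrowCongr Equiv.boolNot)
      fun S => ∑ a : ι → Ω, ∑ b : ι → Ω, D S a b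
  have step : ∀ S : ι → Bool,
      ∑ a : ι → Ω, ∑ b : ι → Ω, (D S a b + D (fun i => !S i) a b) ≤
        2 * (Fintype.card Ω ^ Fintype.card ι * ∑ c : ι → Ω, φ (u ∘ c)) := by
    intro S
    have h := hφ (ι → Ω) (fun a i => if S i then u (a i) else 0)
      (fun a i => if S i then 0 else u (a i))
    have rhs : ∑ a : ι → Ω, ∑ b : ι → Ω,
        φ ((fun i => if S i then u (a i) else 0) - fun i => if S i then 0 else u (b i)) =
        Fintype.card Ω ^ Fintype.card ι * ∑ c : ι → Ω, φ (u ∘ c) := by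
      have := (mixEquiv σ S).sum_comp fun c => φ (u ∘ c.1)
      rw [Fintype.sum_prod_type, Fintype.sum_prod_type] at this
      simp only [Finset.sum_const, Finset.card_univ, Fintype.card_fun, nsmul_eq_mul,
        ← Finset.mul_sum, Nat.cast_pow] at this
      rw [← this]
      refine Finset.sum_congr rfl fun a _ => Finset.sum_congr rfl fun b _ => ?_
      congr 1
      ext i
      by_cases hi : S i <;> simp [mixEquiv, hi, hσ]
    rw [rhs] at h
    refine le_of_eq_of_le (Finset.sum_congr rfl fun a _ => Finset.sum_congr rfl fun b _ => ?_) h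
    simp only [D]
    congr 2 <;> ext i <;> by_cases hi : S i <;> simp [hi]
  have total := Finset.sum_le_sum fun S (_ : S ∈ Finset.univ) => step S
  simp only [Finset.sum_add_distrib] at total
  rw [compl, ← lhs] at total
  simp only [Finset.sum_const, Finset.card_univ, Fintype.card_fun, nsmul_eq_mul,
    Fintype.card_bool, Nat.cast_pow, Nat.cast_ofNat] at total
  linarith

/-- There are integer random variables attaining the value `2 ^ k` for which vectors of
independent copies have, on average, no larger value of a function of negative type than
the vectors with all coordinates `±1` allow. -/
lemma exists_spread_displacement (k : ℕ) :
    ∃ (Ω : Type) (_ : Fintype Ω) (u : Ω → ℤ) (a : Ω), u a = 2 ^ k ∧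
      ∀ (ι : Type) [Fintype ι] [DecidableEq ι] (φ : (ι → ℤ) → ℝ), IsNegType φ →
        ∀ C : ℝ, (∀ v : ι → ℤ, (∀ i, |v i| = 1) → φ v ≤ C) →
          ∑ c : ι → Ω, φ (u ∘ c) ≤ (Fintype.card Ω : ℝ) ^ Fintype.card ι * C := by
  suffices H : ∃ (Ω : Type) (_ : Fintype Ω) (u : Ω → ℤ) (σ : Equiv.Perm Ω),
      (∀ a, u (σ a) = -u a) ∧ (∃ a, u a = 2 ^ k) ∧
      ∀ (ι : Type) [Fintype ι] [DecidableEq ι] (φ : (ι → ℤ) → ℝ), IsNegType φ →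
        ∀ C : ℝ, (∀ v : ι → ℤ, (∀ i, |v i| = 1) → φ v ≤ C) →
          ∑ c : ι → Ω, φ (u ∘ c) ≤ (Fintype.card Ω : ℝ) ^ Fintype.card ι * C by
    obtain ⟨Ω, hΩ, u, -, -, ⟨a, ha⟩, h⟩ := H
    exact ⟨Ω, hΩ, u, a, ha, h⟩
  induction k with
  | zero =>
    refine ⟨Bool, inferInstance, fun b => if b then 1 else -1, Equiv.boolNot, ?_, ⟨true, by simp⟩,
      ?_⟩
    · rintro (_ | _) <;> simp
    · intro ι _ _ φ _ C hC
      have : ∀ c ∈ (Finset.univ : Finset (ι → Bool)),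
          φ ((fun b : Bool => if b then (1 : ℤ) else -1) ∘ c) ≤ C := fun c _ =>
        hC _ fun i => by cases h : c i <;> simp [h]
      refine (Finset.sum_le_card_nsmul _ _ _ this).trans_eq ?_
      simp
  | succ k ih =>
    obtain ⟨Ω, _, u, σ, hσ, ⟨a, ha⟩, h⟩ := ih
    refine ⟨Bool × Ω × Ω, inferInstance, lazyDiff u,
      (Equiv.refl _).prodCongr (Equiv.prodComm _ _), ?_, ⟨(true, a, σ a), ?_⟩, ?_⟩
    · rintro ⟨_ | _, b, c⟩ <;> simp [lazyDiff]
    · simp only [lazyDiff, if_true, hσ, ha]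
      ring
    · intro ι _ _ φ hφ C hC
      refine (sum_lazyDiff_le hφ u σ hσ).trans ?_
      calc _ ≤ (2 : ℝ) ^ Fintype.card ι * Fintype.card Ω ^ Fintype.card ι *
            (Fintype.card Ω ^ Fintype.card ι * C) := by
            gcongr
            exact h ι φ hφ C hC
        _ = _ := by
            simp only [Fintype.card_prod, Fintype.card_bool]
            push_cast
            ring

end RandomDisplacement

section Torus

/-- The cyclic distance between the points of `L_n` coming from residues modulo `n ^ (2 * n)`
that differ by `n ^ n * s`. -/
lemma cyclicDist_zmod {n : ℕ} (hn : 0 < n) [NeZero (n ^ (2 * n))] (x : ZMod (n ^ (2 * n))) (s : ℤ)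
    (hs : 2 * |s| ≤ (n : ℤ) ^ n) :
    cyclicDist n ((((x + ((n ^ n * s : ℤ) : ZMod (n ^ (2 * n)))).val + 1 : ℕ) : ℝ) / (n : ℝ) ^ n)
      (((x.val + 1 : ℕ) : ℝ) / (n : ℝ) ^ n) = |(s : ℝ)| := by
  set q : ℤ := (n : ℤ) ^ n with hq
  have hq0 : 0 < q := by positivity
  have hT : ((n ^ (2 * n) : ℕ) : ℤ) = q * q := by
    rw [hq]; push_cast; ring
  set y := x + ((q * s : ℤ) : ZMod (n ^ (2 * n))) with hy
  obtain ⟨m, hm⟩ : q * q ∣ (y.val : ℤ) - x.val - q * s := by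
    rw [← hT, ← ZMod.intCast_zmod_eq_zero_iff_dvd]
    simp [hy]
  have hx : (x.val : ℤ) < q * q := by rw [← hT]; exact_mod_cast x.val_lt
  have hy' : (y.val : ℤ) < q * q := by rw [← hT]; exact_mod_cast y.val_lt
  have hx0 : (0 : ℤ) ≤ x.val := by positivity
  have hy0 : (0 : ℤ) ≤ y.val := by positivity
  obtain ⟨hs1, hs2⟩ := abs_le.1 (show |2 * s| ≤ q by rwa [abs_mul, abs_two])
  set d : ℤ := (y.val : ℤ) - x.val with hd
  have hdm : d = q * (s + q * m) := by linarith
  have hlt : s + q * m < q := by nlinarith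
  have hgt : -q < s + q * m := by nlinarith
  have hm1 : m < 2 := by nlinarith
  have hm2 : -2 < m := by nlinarith
  have hqR : (0 : ℝ) < (n : ℝ) ^ n := by positivity
  have hdiff : (((y.val + 1 : ℕ) : ℝ) / (n : ℝ) ^ n) - (((x.val + 1 : ℕ) : ℝ) / (n : ℝ) ^ n) =
      ((s + q * m : ℤ) : ℝ) := by
    have : (d : ℝ) = (n : ℝ) ^ n * ((s + q * m : ℤ) : ℝ) := by
      rw [hdm, hq]; push_cast; ring
    rw [← sub_div, div_eq_iff hqR.ne', mul_comm (_ : ℝ) ((n : ℝ) ^ n), ← this, hd]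
    push_cast
    ring
  have hmin : min |s + q * m| (q - |s + q * m|) = |s| := by
    interval_cases m
    · rcases abs_cases s with ⟨h1, _⟩ | ⟨h1, _⟩ <;>
        rcases abs_cases (s + q * -1) with ⟨h2, _⟩ | ⟨h2, _⟩ <;> rw [min_def] <;>
        split_ifs <;> omega
    · rcases abs_cases s with ⟨h1, _⟩ | ⟨h1, _⟩ <;>
        rcases abs_cases (s + q * 0) with ⟨h2, _⟩ | ⟨h2, _⟩ <;> rw [min_def] <;>
        split_ifs <;> omega
    · rcases abs_cases s with ⟨h1, _⟩ | ⟨h1, _⟩ <;>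
        rcases abs_cases (s + q * 1) with ⟨h2, _⟩ | ⟨h2, _⟩ <;> rw [min_def] <;>
        split_ifs <;> omega
  rw [cyclicDist, hdiff]
  have := congrArg (Int.cast : ℤ → ℝ) hmin
  rw [hq] at this ⊢
  push_cast at this ⊢
  exact this

/-- The point of `𝔷` in the component `M_n` with coordinates given by residues. -/
noncomputable def torusPoint {n : ℕ} (hn : 0 < n) (he : Even n)
    (g : Fin (n ^ n) → ZMod (n ^ (2 * n))) : ZSpace :=
  ⟨(n, fun i => if h : i < n ^ n then (((g ⟨i, h⟩).val + 1 : ℕ) : ℝ) / (n : ℝ) ^ n else 0), hn, he,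
    fun i hi => ⟨(g ⟨i, hi⟩).val + 1, by omega, by
      have : NeZero (n ^ (2 * n)) := ⟨by positivity⟩
      exact (g ⟨i, hi⟩).val_lt, by simp [hi]⟩,
    fun i hi => by simp [hi.not_gt]⟩

/-- Scaling of integer vectors by `n ^ n`, into the torus underlying `M_n`. -/
def torusScale (n : ℕ) : (Fin (n ^ n) → ℤ) →+ (Fin (n ^ n) → ZMod (n ^ (2 * n))) where
  toFun v i := ((n ^ n * v i : ℤ) : ZMod (n ^ (2 * n)))
  map_zero' := by ext; simp
  map_add' a b := by ext; simp [mul_add]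

lemma zetaDist_torusPoint {n : ℕ} (hn : 0 < n) (he : Even n)
    (g : Fin (n ^ n) → ZMod (n ^ (2 * n))) (v : Fin (n ^ n) → ℤ) :
    zetaDist (torusPoint hn he (g + torusScale n v)) (torusPoint hn he g) =
      ⨆ i, cyclicDist n
        ((((g i + ((n ^ n * v i : ℤ) : ZMod (n ^ (2 * n)))).val + 1 : ℕ) : ℝ) / (n : ℝ) ^ n)
        ((((g i).val + 1 : ℕ) : ℝ) / (n : ℝ) ^ n) := by
  simp [zetaDist, zeta, torusPoint, supDistF, torusScale]

lemma zetaDist_torusPoint_le_one {n : ℕ} (hn : 0 < n) (he : Even n)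
    (g : Fin (n ^ n) → ZMod (n ^ (2 * n))) (v : Fin (n ^ n) → ℤ) (hv : ∀ i, |v i| = 1) :
    zetaDist (torusPoint hn he (g + torusScale n v)) (torusPoint hn he g) ≤ 1 := by
  have : NeZero (n ^ (2 * n)) := ⟨by positivity⟩
  have h2 : 2 ≤ n := by obtain ⟨m, rfl⟩ := he; omega
  rw [zetaDist_torusPoint]
  refine Real.iSup_le (fun i => ?_) zero_le_one
  rw [cyclicDist_zmod hn]
  · exact_mod_cast (hv i).le
  · rw [hv i]
    exact_mod_cast h2.trans (Nat.le_self_pow hn.ne' n)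

lemma le_zetaDist_torusPoint {n : ℕ} (hn : 0 < n) (he : Even n)
    (g : Fin (n ^ n) → ZMod (n ^ (2 * n))) (v : Fin (n ^ n) → ℤ) (i : Fin (n ^ n))
    (hv : 2 * |v i| ≤ (n : ℤ) ^ n) :
    |(v i : ℝ)| ≤ zetaDist (torusPoint hn he (g + torusScale n v)) (torusPoint hn he g) := by
  have : NeZero (n ^ (2 * n)) := ⟨by positivity⟩
  rw [zetaDist_torusPoint, ← cyclicDist_zmod hn (g i) (v i) hv]
  exact le_ciSup (f := fun i => cyclicDist n
        ((((g i + ((n ^ n * v i : ℤ) : ZMod (n ^ (2 * n)))).val + 1 : ℕ) : ℝ) / (n : ℝ) ^ n)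
        ((((g i).val + 1 : ℕ) : ℝ) / (n : ℝ) ^ n)) (Set.finite_range _).bddAbove i

end Torus

/-- If at least half of all functions take the value `a` somewhere, a lower bound on these
functions bounds the total sum. -/
lemma half_card_mul_le_sum {ι Ω : Type*} [Fintype ι] [DecidableEq ι] [Fintype Ω] (a : Ω)
    (hcard : (1 - 1 / (Fintype.card Ω : ℝ)) ^ Fintype.card ι ≤ 1 / 2)
    (ψ : (ι → Ω) → ℝ) (hψ : ∀ c, 0 ≤ ψ c) {L : ℝ} (hL : 0 ≤ L)
    (hlarge : ∀ c i, c i = a → L ≤ ψ c) :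
    (Fintype.card Ω : ℝ) ^ Fintype.card ι * L / 2 ≤ ∑ c, ψ c := by
  classical
  let A : Finset (ι → Ω) := Fintype.piFinset fun _ => Finset.univ.erase a
  have hpos : 0 < Fintype.card Ω := Fintype.card_pos_iff.2 ⟨a⟩
  have hA : (A.card : ℝ) ≤ (Fintype.card Ω : ℝ) ^ Fintype.card ι / 2 := by
    have : (A.card : ℝ) = (Fintype.card Ω : ℝ) ^ Fintype.card ι *
        (1 - 1 / (Fintype.card Ω : ℝ)) ^ Fintype.card ι := by
      rw [← mul_pow, mul_sub, mul_one_div_cancel (by positivity)]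
      simp [A, Finset.card_erase_of_mem, Nat.cast_sub (show 1 ≤ Fintype.card Ω from hpos)]
    rw [this]
    have : (0 : ℝ) ≤ (Fintype.card Ω : ℝ) ^ Fintype.card ι := by positivity
    nlinarith
  have hAc : ((Aᶜ).card : ℝ) = (Fintype.card Ω : ℝ) ^ Fintype.card ι - A.card := by
    rw [Finset.card_compl, Nat.cast_sub (Finset.card_le_univ _)]
    simp
  calc (Fintype.card Ω : ℝ) ^ Fintype.card ι * L / 2 ≤ (Aᶜ).card * L := by
        rw [hAc]; nlinarith
    _ = ∑ c ∈ Aᶜ, L := by simp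
    _ ≤ ∑ c ∈ Aᶜ, ψ c := by
        refine Finset.sum_le_sum fun c hc => ?_
        obtain ⟨i, hi⟩ : ∃ i, c i = a := by simpa [A] using hc
        exact hlarge c i hi
    _ ≤ ∑ c, ψ c := Finset.sum_le_univ_sum_of_nonneg hψ

lemma exists_pos_mem_grSet {X : Type*} {d : X → X → ℝ} (h : 0 < genRoundness d) :
    ∃ p ∈ grSet d, 0 < p := by
  obtain ⟨_, ⟨p, hp, rfl⟩, hpos⟩ := lt_sSup_iff.1 h
  exact ⟨p, hp, ENNReal.ofReal_pos.1 hpos⟩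

/-- Theorem 2 of the paper: the locally finite metric space `(𝔷, ζ)`
does not coarsely embed into any metric space of non zero generalized roundness. -/
theorem Z_not_coarsely_embeddable {B : Type*} [MetricSpace B]
    (hB : 0 < genRoundness (dist : B → B → ℝ)) (f : ZSpace → B) :
    ¬ IsCoarseEmbeddingWith zetaDist (dist : B → B → ℝ) f := by
  rintro ⟨ρ₁, ρ₂, hρ₁, hρ₂, hf, hlim⟩
  obtain ⟨p, hp, hp0⟩ := exists_pos_mem_grSet hB
  obtain ⟨k, hk1, hk⟩ : ∃ k : ℕ, 0 ≤ ρ₁ (2 ^ k) ∧ 2 * ρ₂ 1 ^ p < ρ₁ (2 ^ k) ^ p := by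
    have h2 : Filter.Tendsto (fun k : ℕ => ρ₁ (2 ^ k)) Filter.atTop Filter.atTop :=
      hlim.comp (tendsto_pow_atTop_atTop_of_one_lt one_lt_two)
    exact ((h2.eventually_ge_atTop 0).and
      (((tendsto_rpow_atTop hp0).comp h2).eventually_gt_atTop _)).exists
  obtain ⟨Ω, _, u, a, hua, hsum⟩ := exists_spread_displacement k
  have hΩ : 0 < Fintype.card Ω := Fintype.card_pos_iff.2 ⟨a⟩
  have hΩ1 : (1 : ℝ) ≤ Fintype.card Ω := by exact_mod_cast hΩ
  have hc0 : 0 ≤ 1 - 1 / (Fintype.card Ω : ℝ) := by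
    rw [sub_nonneg, div_le_one (by positivity)]
    exact hΩ1
  have hc1 : 1 - 1 / (Fintype.card Ω : ℝ) < 1 := by
    have : 0 < 1 / (Fintype.card Ω : ℝ) := by positivity
    linarith
  obtain ⟨m, hm, hmk⟩ := (((tendsto_pow_atTop_nhds_zero_of_lt_one hc0 hc1).eventually_le_const
    (show (0 : ℝ) < 1 / 2 by norm_num)).and (Filter.eventually_ge_atTop (2 * 2 ^ k))).exists
  have hm0 : 0 < m := lt_of_lt_of_le (by positivity) hmk
  obtain ⟨n, hn, he, hmn⟩ : ∃ n, 0 < n ∧ Even n ∧ m ≤ n ^ n :=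
    ⟨2 * m, by omega, even_two_mul m,
      (show m ≤ 2 * m by omega).trans (Nat.le_self_pow (by omega) _)⟩
  have : NeZero (n ^ (2 * n)) := ⟨by positivity⟩
  let F : (Fin (n ^ n) → ZMod (n ^ (2 * n))) → B := fun g => f (torusPoint hn he g)
  let φ : (Fin (n ^ n) → ℤ) → ℝ := fun v => ∑ g, dist (F (g + torusScale n v)) (F g) ^ p
  let N : ℝ := Fintype.card (Fin (n ^ n) → ZMod (n ^ (2 * n)))
  have hN : 0 < N := Nat.cast_pos.2 Fintype.card_pos
  have upper := hsum (Fin (n ^ n)) φ (isNegType_sum_dist_rpow hp0 hp (torusScale n) F)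
    (N * ρ₂ 1 ^ p) fun v hv => by
      refine (Finset.sum_le_card_nsmul _ _ (ρ₂ 1 ^ p) fun g _ => ?_).trans_eq
        (by rw [nsmul_eq_mul, Finset.card_univ])
      exact Real.rpow_le_rpow dist_nonneg
        ((hf _ _).2.trans (hρ₂ (zetaDist_torusPoint_le_one hn he g v hv))) hp0.le
  have lower := half_card_mul_le_sum (ι := Fin (n ^ n)) a
    ((pow_le_pow_of_le_one hc0 hc1.le (by simpa using hmn)).trans hm) (fun c => φ (u ∘ c))
    (fun c => Finset.sum_nonneg fun g _ => by positivity)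
    (L := N * ρ₁ (2 ^ k) ^ p) (by positivity) fun c i hi => by
      refine le_of_eq_of_le (by rw [nsmul_eq_mul, Finset.card_univ])
        (Finset.card_nsmul_le_sum _ _ (ρ₁ (2 ^ k) ^ p) fun g _ => ?_)
      have hui : (u ∘ c) i = 2 ^ k := by simp [hi, hua]
      have hle := le_zetaDist_torusPoint hn he g (u ∘ c) i (by
        rw [hui, abs_of_nonneg (by positivity)]
        exact_mod_cast hmk.trans hmn)
      rw [hui] at hle
      refine Real.rpow_le_rpow hk1 ((hρ₁ ?_).trans (hf _ _).1) hp0.le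
      simpa using hle
  have hW : (0 : ℝ) < (Fintype.card Ω : ℝ) ^ Fintype.card (Fin (n ^ n)) := by positivity
  have := mul_lt_mul_of_pos_left hk (mul_pos hW hN)
  linarith
end

section
/- The locally finite metric space (𝔷,ζ) has generalized roundness 0: 𝔮(𝔷) = 0. -/
/-- The point of `M_n` with entries in `{1, 2, 3}` which represents the `i`-th vertex of the
side `c ∈ {0, 1}` of a complete bipartite graph with its path metric. -/
noncomputable def bipartitePoint (n c i : ℕ) : ℕ → ℝ := fun k =>
  if k < n ^ n then if k % 2 = c then if k = 2 * i + c then 1 else 3 else 2 else 0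

lemma four_le_self_pow_self {n : ℕ} (hn : 2 ≤ n) : 4 ≤ n ^ n :=
  calc 4 = 2 ^ 2 := by norm_num
    _ ≤ n ^ 2 := Nat.pow_le_pow_left hn 2
    _ ≤ n ^ n := Nat.pow_le_pow_right (by omega) hn

lemma natCast_mem_Ln {n : ℕ} (hn : 2 ≤ n) {a : ℕ} (h1 : 1 ≤ a) (h3 : a ≤ 4) :
    (a : ℝ) ∈ Ln n := by
  have h4 := four_le_self_pow_self hn
  refine ⟨a * n ^ n, Nat.mul_pos h1 (by omega), ?_, ?_⟩
  · rw [two_mul, pow_add]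
    exact Nat.mul_le_mul_right _ (h3.trans h4)
  · have : ((n : ℝ) ^ n) ≠ 0 := by positivity
    push_cast
    field_simp

lemma bipartitePoint_mem_MnF {n : ℕ} (hn : 2 ≤ n) (c i : ℕ) :
    bipartitePoint n c i ∈ MnF n := by
  refine ⟨fun k hk => ?_, fun k hk => ?_⟩
  · have h1 := natCast_mem_Ln hn (a := 1) (by norm_num) (by norm_num)
    have h2 := natCast_mem_Ln hn (a := 2) (by norm_num) (by norm_num)
    have h3 := natCast_mem_Ln hn (a := 3) (by norm_num) (by norm_num)
    push_cast at h1 h2 h3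
    simp only [bipartitePoint, if_pos hk]
    split_ifs <;> assumption
  · simp [bipartitePoint, Nat.not_lt.mpr hk]

lemma cyclicDist_eq_abs_sub {n : ℕ} (hn : 2 ≤ n) {a b : ℝ} (h : |a - b| ≤ 2) :
    cyclicDist n a b = |a - b| := by
  have h4 : (4 : ℝ) ≤ (n : ℝ) ^ n := by exact_mod_cast four_le_self_pow_self hn
  exact min_eq_left (by linarith)

lemma cyclicDist_bipartitePoint_of_ne {n : ℕ} (hn : 2 ≤ n) {c c' : ℕ} (hc : c < 2)
    (hc' : c' < 2) (h : c ≠ c') (i j : ℕ) {k : ℕ} (hk : k < n ^ n) :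
    cyclicDist n (bipartitePoint n c i k) (bipartitePoint n c' j k) = 1 := by
  have key : |bipartitePoint n c i k - bipartitePoint n c' j k| = 1 := by
    simp only [bipartitePoint, if_pos hk]
    split_ifs <;> first | omega | norm_num
  rw [cyclicDist_eq_abs_sub hn (by rw [key]; norm_num), key]

lemma abs_sub_bipartitePoint_le (n c i j k : ℕ) :
    |bipartitePoint n c i k - bipartitePoint n c j k| ≤ 2 := by
  simp only [bipartitePoint]
  split_ifs <;> norm_num

lemma supDistF_bipartitePoint_of_ne {n : ℕ} (hn : 2 ≤ n) {c c' : ℕ} (hc : c < 2)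
    (hc' : c' < 2) (h : c ≠ c') (i j : ℕ) :
    supDistF n (bipartitePoint n c i) (bipartitePoint n c' j) = 1 := by
  have : Nonempty (Fin (n ^ n)) := ⟨⟨0, by have := four_le_self_pow_self hn; omega⟩⟩
  rw [supDistF, ← ciSup_const (ι := Fin (n ^ n)) (a := (1 : ℝ))]
  exact iSup_congr fun k => cyclicDist_bipartitePoint_of_ne hn hc hc' h i j k.2

lemma supDistF_bipartitePoint_same_side {n : ℕ} (hn : 2 ≤ n) {c i j : ℕ}
    (hi : 2 * i + c < n) (hij : i ≠ j) (hc : c < 2) :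
    supDistF n (bipartitePoint n c i) (bipartitePoint n c j) = 2 := by
  have hlt : 2 * i + c < n ^ n := hi.trans_le (Nat.le_self_pow (by omega) n)
  have : Nonempty (Fin (n ^ n)) := ⟨⟨_, hlt⟩⟩
  have hle : ∀ k : Fin (n ^ n),
      cyclicDist n (bipartitePoint n c i k) (bipartitePoint n c j k) ≤ 2 := fun k =>
    (min_le_left _ _).trans (abs_sub_bipartitePoint_le n c i j k)
  refine le_antisymm (ciSup_le hle) ?_
  refine le_trans (le_of_eq ?_) (le_ciSup (f := fun k : Fin (n ^ n) =>
    cyclicDist n (bipartitePoint n c i k) (bipartitePoint n c j k))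
    ⟨2, Set.forall_mem_range.mpr hle⟩ ⟨2 * i + c, hlt⟩)
  rw [cyclicDist_eq_abs_sub hn (abs_sub_bipartitePoint_le ..)]
  have hmod : (2 * i + c) % 2 = c := by omega
  simp only [bipartitePoint, if_pos hlt, if_pos hmod, if_true,
    if_neg (show ¬ 2 * i + c = 2 * j + c by omega)]
  norm_num

lemma sum_sum_ite_lt (m : ℕ) (a : ℝ) :
    2 * (∑ i : Fin m, ∑ j : Fin m, if i < j then a else 0) = m * (m - 1) * a := by
  have hswap : (∑ i : Fin m, ∑ j : Fin m, if i < j then a else 0) =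
      ∑ i : Fin m, ∑ j : Fin m, if j < i then a else 0 := Finset.sum_comm
  have hsplit : (∑ i : Fin m, ∑ j : Fin m, if i < j then a else 0) +
      (∑ i : Fin m, ∑ j : Fin m, if j < i then a else 0) +
      (∑ i : Fin m, ∑ j : Fin m, if i = j then a else 0) = ∑ i : Fin m, ∑ j : Fin m, a := by
    simp only [← Finset.sum_add_distrib]
    refine Finset.sum_congr rfl fun i _ => Finset.sum_congr rfl fun j _ => ?_
    rcases lt_trichotomy i j with h | h | h
    · simp [h, h.not_gt, h.ne]
    · simp [h]
    · simp [h, h.not_gt, h.ne']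
  rw [← hswap] at hsplit
  simp only [Finset.sum_ite_eq, Finset.mem_univ, if_true, Finset.sum_const, Finset.card_univ,
    Fintype.card_fin, nsmul_eq_mul] at hsplit
  linarith

/-- A space containing arbitrarily large complete bipartite graphs `K_{m,m}` with their path
metrics has no positive generalized roundness exponent. -/
lemma grSet_subset_singleton_zero {X : Type*} (d : X → X → ℝ)
    (H : ∀ m : ℕ, 2 ≤ m → ∃ x y : Fin m → X, (∀ i j, i ≠ j → d (x i) (x j) = 2) ∧
      (∀ i j, i ≠ j → d (y i) (y j) = 2) ∧ ∀ i j, d (x i) (y j) = 1) :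
    grSet d ⊆ {0} := by
  rintro p ⟨hp0, hp⟩
  by_contra hne
  have hpos : 0 < p := lt_of_le_of_ne hp0 (Ne.symm hne)
  have htwo : (1 : ℝ) < 2 ^ p := Real.one_lt_rpow (by norm_num) hpos
  obtain ⟨N, hN⟩ := exists_nat_gt ((2 : ℝ) ^ p / (2 ^ p - 1))
  rw [div_lt_iff₀ (by linarith)] at hN
  obtain ⟨x, y, hx, hy, hxy⟩ := H (N + 2) (by omega)
  have hle := hp (N + 2) (by omega) x y
  have hleft : (∑ i, ∑ j, if i < j then d (x i) (x j) ^ p + d (y i) (y j) ^ p else 0) =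
      ∑ i : Fin (N + 2), ∑ j : Fin (N + 2), if i < j then (2 * 2 ^ p : ℝ) else 0 := by
    refine Finset.sum_congr rfl fun i _ => Finset.sum_congr rfl fun j _ => ?_
    split_ifs with h
    · rw [hx i j h.ne, hy i j h.ne, two_mul]
    · rfl
  have hright : ∑ i, ∑ j, d (x i) (y j) ^ p = ((N + 2 : ℕ) : ℝ) * (N + 2 : ℕ) := by
    simp [hxy]
    ring
  have hsum := sum_sum_ite_lt (N + 2) (2 * 2 ^ p)
  rw [hleft, hright] at hle
  push_cast at hle hsum
  have hN0 : (0 : ℝ) < N + 2 := by positivity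
  have : ((N : ℝ) + 2) * ((N + 1) * 2 ^ p) ≤ (N + 2) * (N + 2) := by linarith
  have := le_of_mul_le_mul_left this hN0
  linarith

lemma exists_bipartite_in_ZSpace (m : ℕ) (hm : 2 ≤ m) :
    ∃ x y : Fin m → ZSpace, (∀ i j, i ≠ j → zetaDist (x i) (x j) = 2) ∧
      (∀ i j, i ≠ j → zetaDist (y i) (y j) = 2) ∧ ∀ i j, zetaDist (x i) (y j) = 1 := by
  have hn : 2 ≤ 2 * m := by omega
  have hmem : ∀ c i, ((2 * m, bipartitePoint (2 * m) c i) : ℕ × (ℕ → ℝ)) ∈ ZSpace := fun c i =>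
    ⟨by simp only; omega, even_two_mul m, bipartitePoint_mem_MnF hn c i⟩
  refine ⟨fun i => ⟨_, hmem 0 i⟩, fun i => ⟨_, hmem 1 i⟩, fun i j hij => ?_, fun i j hij => ?_,
    fun i j => ?_⟩
  · simpa only [zetaDist, zeta, if_true] using supDistF_bipartitePoint_same_side hn
      (by omega) (Fin.val_ne_of_ne hij) (by norm_num)
  · simpa only [zetaDist, zeta, if_true] using supDistF_bipartitePoint_same_side hn
      (by omega) (Fin.val_ne_of_ne hij) (by norm_num)
  · simpa only [zetaDist, zeta, if_true] using supDistF_bipartitePoint_of_ne hn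
      (by norm_num) (by norm_num) (by norm_num) i j

/-- the locally finite metric space `(𝔷, ζ)` has generalized
roundness `0`. -/
theorem Z_genRoundness_zero : genRoundness zetaDist = 0 := by
  refine le_antisymm (sSup_le ?_) zero_le
  rintro _ ⟨p, hp, rfl⟩
  have h := grSet_subset_singleton_zero zetaDist exists_bipartite_in_ZSpace hp
  rw [Set.mem_singleton_iff.mp h, ENNReal.ofReal_zero]
end

section
/- No universal coarse embedding space has non zero generalized roundness: if (X,d) is a metric space such that every locally finite metric space coarsely embeds into X, then 𝔮(X) = 0. -/
/-- A metric space is locally finite if all of its bounded subsets are finite. -/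
def LocallyFiniteSpace (Z : Type*) [MetricSpace Z] : Prop :=
  ∀ s : Set Z, Bornology.IsBounded s → s.Finite

/-- A kernel `φ` satisfies the roundness inequality for `n`-point configurations. -/
def RoundnessIneq {G : Type*} (n : ℕ) (φ : G → G → ℝ) : Prop :=
  ∀ x y : Fin n → G,
    (∑ i, ∑ j, if i < j then φ (x i) (x j) + φ (y i) (y j) else 0) ≤ ∑ i, ∑ j, φ (x i) (y j)

lemma sum_ite_lt_add_self (n : ℕ) (b : ℝ) :
    (∑ i : Fin n, ∑ j : Fin n, if i < j then b + b else 0) = n * (n - 1) * b := by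
  have hsymm : (∑ i : Fin n, ∑ j : Fin n, if i < j then b else 0) =
      ∑ i : Fin n, ∑ j : Fin n, if j < i then b else 0 := Finset.sum_comm
  have hsplit : (∑ i : Fin n, ∑ j : Fin n, if i < j then b + b else 0) =
      (∑ i : Fin n, ∑ j : Fin n, if i < j then b else 0) +
        ∑ i : Fin n, ∑ j : Fin n, if i < j then b else 0 := by
    simp only [← Finset.sum_add_distrib]
    refine Finset.sum_congr rfl fun i _ => Finset.sum_congr rfl fun j _ => ?_
    split_ifs <;> simp
  have hdiag : (∑ i : Fin n, ∑ j : Fin n, if i < j then b else 0) +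
      (∑ i : Fin n, ∑ j : Fin n, if j < i then b else 0) =
        ∑ i : Fin n, ∑ j : Fin n, (b - if i = j then b else 0) := by
    simp only [← Finset.sum_add_distrib]
    refine Finset.sum_congr rfl fun i _ => Finset.sum_congr rfl fun j _ => ?_
    rcases lt_trichotomy i j with h | h | h
    · simp [h, h.not_gt, h.ne]
    · simp [h]
    · simp [h, h.not_gt, h.ne']
  rw [hsplit]
  nth_rewrite 2 [hsymm]
  rw [hdiag]
  simp [Finset.sum_sub_distrib]
  ring

/-- The signed permutation `(σ, ε)` applied to the integer vector `w`, reduced to `R`. -/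
def signedPerm {ι : Type*} (R : Type*) [CommRing R] (σ : Equiv.Perm ι) (ε : ι → ℤˣ) (w : ι → ℤ) :
    ι → R :=
  fun c => (((ε c : ℤ) * w (σ c) : ℤ) : R)

lemma signedPerm_sub {ι R : Type*} [CommRing R] (σ : Equiv.Perm ι) (ε : ι → ℤˣ) (a b : ι → ℤ) :
    signedPerm R σ ε (b - a) = signedPerm R σ ε b - signedPerm R σ ε a := by
  funext c
  simp [signedPerm, mul_sub]

section Symmetrization

variable {ι R : Type*} [Fintype ι] [DecidableEq ι] [CommRing R] [Fintype R]

/-- The total of a kernel over all translates of all signed permutations of the difference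
vector `w`. -/
def symmetrization (φ : (ι → R) → (ι → R) → ℝ) (w : ι → ℤ) : ℝ :=
  ∑ σ : Equiv.Perm ι, ∑ ε : ι → ℤˣ, ∑ z : ι → R, φ z (z + signedPerm R σ ε w)

lemma symmetrization_signedPerm (φ : (ι → R) → (ι → R) → ℝ) (τ : Equiv.Perm ι) (η : ι → ℤˣ)
    (w : ι → ℤ) :
    symmetrization φ (fun c => (η c : ℤ) * w (τ c)) = symmetrization φ w := by
  unfold symmetrization
  refine Fintype.sum_equiv (Equiv.mulLeft τ) _ _ fun σ => ?_
  refine Fintype.sum_equiv (Equiv.mulRight (η ∘ σ)) _ _ fun ε => ?_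
  refine Finset.sum_congr rfl fun z _ => ?_
  congr 2
  funext c
  simp [signedPerm, mul_assoc]

lemma sum_signedPerm_pair (φ : (ι → R) → (ι → R) → ℝ) (a b : ι → ℤ) :
    ∑ σ : Equiv.Perm ι, ∑ ε : ι → ℤˣ, ∑ z : ι → R,
      φ (z + signedPerm R σ ε a) (z + signedPerm R σ ε b) = symmetrization φ (b - a) := by
  unfold symmetrization
  refine Finset.sum_congr rfl fun σ _ => Finset.sum_congr rfl fun ε _ => ?_
  refine Fintype.sum_equiv (Equiv.addRight (signedPerm R σ ε a)) _ _ fun z => ?_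
  simp [signedPerm_sub, add_assoc]

lemma RoundnessIneq.symmetrization_le {n : ℕ} {φ : (ι → R) → (ι → R) → ℝ}
    (hφ : RoundnessIneq n φ) (x y : Fin n → ι → ℤ) :
    (∑ i, ∑ j, if i < j then symmetrization φ (x j - x i) + symmetrization φ (y j - y i) else 0) ≤
      ∑ i, ∑ j, symmetrization φ (y j - x i) := by
  have key : ∑ σ : Equiv.Perm ι, ∑ ε : ι → ℤˣ, ∑ z : ι → R,
      (∑ i, ∑ j, if i < j then φ (z + signedPerm R σ ε (x i)) (z + signedPerm R σ ε (x j)) +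
        φ (z + signedPerm R σ ε (y i)) (z + signedPerm R σ ε (y j)) else 0) ≤
      ∑ σ : Equiv.Perm ι, ∑ ε : ι → ℤˣ, ∑ z : ι → R,
      ∑ i, ∑ j, φ (z + signedPerm R σ ε (x i)) (z + signedPerm R σ ε (y j)) :=
    Finset.sum_le_sum fun σ _ => Finset.sum_le_sum fun ε _ => Finset.sum_le_sum fun z _ =>
      hφ (fun i => z + signedPerm R σ ε (x i)) (fun i => z + signedPerm R σ ε (y i))
  have swap : ∀ F : Equiv.Perm ι → (ι → ℤˣ) → (ι → R) → Fin n → Fin n → ℝ,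
      ∑ σ, ∑ ε, ∑ z, ∑ i, ∑ j, F σ ε z i j = ∑ i, ∑ j, ∑ σ, ∑ ε, ∑ z, F σ ε z i j := by
    intro F
    simp only [← Fintype.sum_prod_type']
    exact Fintype.sum_equiv ⟨fun x => (x.2.2.2.1, x.2.2.2.2, x.1, x.2.1, x.2.2.1),
      fun x => (x.2.2.1, x.2.2.2.1, x.2.2.2.2, x.1, x.2.1), fun _ => rfl, fun _ => rfl⟩ _ _
      fun _ => rfl
  rw [swap, swap] at key
  simp only [sum_signedPerm_pair] at key
  refine le_trans (le_of_eq ?_) key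
  refine Finset.sum_congr rfl fun i _ => Finset.sum_congr rfl fun j _ => ?_
  split_ifs
  · simp only [Finset.sum_add_distrib, sum_signedPerm_pair]
  · simp

lemma RoundnessIneq.symmetrization_const_le {n : ℕ} {φ : (ι → R) → (ι → R) → ℝ}
    (hφ : RoundnessIneq n φ) (hn : 0 < n) (x y : Fin n → ι → ℤ) {a b : ℝ}
    (hx : ∀ i j, i ≠ j → symmetrization φ (x j - x i) = b)
    (hy : ∀ i j, i ≠ j → symmetrization φ (y j - y i) = b)
    (hxy : ∀ i j, symmetrization φ (y j - x i) = a) :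
    ((n : ℝ) - 1) * b ≤ n * a := by
  have h := hφ.symmetrization_le x y
  have hl : (∑ i, ∑ j, if i < j then
      symmetrization φ (x j - x i) + symmetrization φ (y j - y i) else 0) = n * (n - 1) * b := by
    rw [← sum_ite_lt_add_self]
    refine Finset.sum_congr rfl fun i _ => Finset.sum_congr rfl fun j _ => ?_
    split_ifs with hij
    · rw [hx i j hij.ne, hy i j hij.ne]
    · rfl
  rw [hl] at h
  simp only [hxy, Finset.sum_const, Finset.card_univ, Fintype.card_fin, nsmul_eq_mul] at h
  have hn' : (0 : ℝ) < n := by exact_mod_cast hn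
  refine le_of_mul_le_mul_left ?_ hn'
  linarith

lemma symmetrization_eq_sum_prod (φ : (ι → R) → (ι → R) → ℝ) (w : ι → ℤ) :
    symmetrization φ w = ∑ x : Equiv.Perm ι × (ι → ℤˣ) × (ι → R),
      φ x.2.2 (x.2.2 + signedPerm R x.1 x.2.1 w) := by
  simp only [symmetrization, ← Fintype.sum_prod_type']

lemma symmetrization_le_card_mul {φ : (ι → R) → (ι → R) → ℝ} {w : ι → ℤ} {B : ℝ}
    (hB : ∀ σ ε z, φ z (z + signedPerm R σ ε w) ≤ B) :
    symmetrization φ w ≤ Fintype.card (Equiv.Perm ι × (ι → ℤˣ) × (ι → R)) * B := by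
  rw [symmetrization_eq_sum_prod, ← nsmul_eq_mul]
  exact Finset.sum_le_card_nsmul _ _ _ fun x _ => hB _ _ _

lemma card_mul_le_symmetrization {φ : (ι → R) → (ι → R) → ℝ} {w : ι → ℤ} {A : ℝ}
    (hA : ∀ σ ε z, A ≤ φ z (z + signedPerm R σ ε w)) :
    Fintype.card (Equiv.Perm ι × (ι → ℤˣ) × (ι → R)) * A ≤ symmetrization φ w := by
  rw [symmetrization_eq_sum_prod, ← nsmul_eq_mul]
  exact Finset.card_nsmul_le_sum _ _ _ fun x _ => hA _ _ _

lemma mul_le_of_mul_symmetrization_le {φ : (ι → R) → (ι → R) → ℝ} {v w : ι → ℤ} {r A B : ℝ}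
    (hr : 0 ≤ r) (h : r * symmetrization φ v ≤ symmetrization φ w)
    (hA : ∀ σ ε z, A ≤ φ z (z + signedPerm R σ ε v))
    (hB : ∀ σ ε z, φ z (z + signedPerm R σ ε w) ≤ B) : r * A ≤ B := by
  have hT : (0 : ℝ) < Fintype.card (Equiv.Perm ι × (ι → ℤˣ) × (ι → R)) := by
    exact_mod_cast Fintype.card_pos
  refine le_of_mul_le_mul_left ?_ hT
  have hlow := mul_le_mul_of_nonneg_left (card_mul_le_symmetrization hA) hr
  have hup := symmetrization_le_card_mul hB
  linarith

end Symmetrization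

/-- Two vectors with entries in `{-1, 0, 1}` and equally many nonzero entries differ by a signed
permutation of the coordinates. -/
lemma exists_signedPerm {ι : Type*} [Fintype ι] [DecidableEq ι] (u v : ι → ℤ)
    (hu : ∀ c, u c = 0 ∨ IsUnit (u c)) (hv : ∀ c, v c = 0 ∨ IsUnit (v c))
    (hcard : Fintype.card {c // u c ≠ 0} = Fintype.card {c // v c ≠ 0}) :
    ∃ (τ : Equiv.Perm ι) (η : ι → ℤˣ), ∀ c, v c = η c * u (τ c) := by
  obtain ⟨e⟩ := Fintype.card_eq.1 hcard.symm
  have h : ∀ c, ∃ a : ℤˣ, v c = a * u (e.extendSubtype c) := by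
    intro c
    by_cases hc : v c = 0
    · have := e.extendSubtype_not_mem c (by simpa using hc)
      refine ⟨1, ?_⟩
      simp only [ne_eq, not_not] at this
      simp [hc, this]
    · have hc' : u (e.extendSubtype c) ≠ 0 := e.extendSubtype_mem c hc
      obtain ⟨a, ha⟩ := (hv c).resolve_left hc
      obtain ⟨b, hb⟩ := (hu _).resolve_left hc'
      refine ⟨a * b⁻¹, ?_⟩
      rw [← ha, ← hb, ← Units.val_mul, inv_mul_cancel_right]
  choose η hη using h
  exact ⟨e.extendSubtype, η, hη⟩

lemma symmetrization_smul_eq {ι R : Type*} [Fintype ι] [DecidableEq ι] [CommRing R] [Fintype R]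
    (φ : (ι → R) → (ι → R) → ℝ) (t : ℤ) (u v : ι → ℤ)
    (hu : ∀ c, u c = 0 ∨ IsUnit (u c)) (hv : ∀ c, v c = 0 ∨ IsUnit (v c))
    (hcard : Fintype.card {c // u c ≠ 0} = Fintype.card {c // v c ≠ 0}) :
    symmetrization φ (t • v) = symmetrization φ (t • u) := by
  obtain ⟨τ, η, h⟩ := exists_signedPerm u v hu hv hcard
  rw [← symmetrization_signedPerm φ τ η (t • u)]
  congr 1
  funext c
  simp [h c, mul_left_comm]

/-- The coordinates of the `k`-th block of the test space. -/
abbrev Coord (n N : ℕ) : Type := Bool × (Fin n → Bool) × Fin N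

/-- The indicator vector of the coordinates whose last component is less than `L`. -/
def blockVec (n N L : ℕ) : Coord n N → ℤ := fun c => if c.2.2.val < L then 1 else 0

/-- The `i`-th vertex of the side `b` of a bipartite configuration. -/
def sideVec (n N L : ℕ) (b : Bool) (i : Fin n) : Coord n N → ℤ :=
  fun c => if c.1 = b ∧ c.2.2.val < L then (if c.2.1 i then 1 else -1) else 0

/-- Half of the difference of the `j`-th and the `i`-th vertex of the side `b`. -/
def sideHalfDiff (n N L : ℕ) (b : Bool) (i j : Fin n) : Coord n N → ℤ :=
  fun c => if c.1 = b ∧ c.2.1 i ≠ c.2.1 j ∧ c.2.2.val < L then (if c.2.1 j then 1 else -1) else 0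

lemma sideVec_sub_sideVec (n N L : ℕ) (b : Bool) (i j : Fin n) :
    sideVec n N L b j - sideVec n N L b i = (2 : ℤ) • sideHalfDiff n N L b i j := by
  funext ⟨b', f, l⟩
  simp only [sideVec, sideHalfDiff, Pi.sub_apply, Pi.smul_apply]
  by_cases hb : b' = b <;> by_cases hl : l.val < L <;>
    rcases Bool.eq_false_or_eq_true (f i) with hi | hi <;>
    rcases Bool.eq_false_or_eq_true (f j) with hj | hj <;> simp [hb, hl, hi, hj]

lemma isUnit_blockVec (n N L : ℕ) (c : Coord n N) :
    blockVec n N L c = 0 ∨ IsUnit (blockVec n N L c) := by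
  unfold blockVec
  split_ifs <;> simp

lemma isUnit_sideHalfDiff (n N L : ℕ) (b : Bool) (i j : Fin n) (c : Coord n N) :
    sideHalfDiff n N L b i j c = 0 ∨ IsUnit (sideHalfDiff n N L b i j c) := by
  unfold sideHalfDiff
  split_ifs <;> simp

lemma sideVec_sub_cases (n N L : ℕ) (i j : Fin n) (c : Coord n N) :
    (¬ c.2.2.val < L ∧ (sideVec n N L false j - sideVec n N L true i) c = 0) ∨
      (c.2.2.val < L ∧ IsUnit ((sideVec n N L false j - sideVec n N L true i) c)) := by
  obtain ⟨b', f, l⟩ := c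
  simp only [sideVec, Pi.sub_apply]
  by_cases hl : l.val < L <;> cases b' <;>
    rcases Bool.eq_false_or_eq_true (f i) with hi | hi <;>
    rcases Bool.eq_false_or_eq_true (f j) with hj | hj <;> simp [hl, hi, hj]

lemma card_ne_eval {n : ℕ} {i j : Fin n} (hij : i ≠ j) :
    2 * (Finset.univ.filter fun f : Fin n → Bool => f i ≠ f j).card = 2 ^ n := by
  have hcard : (Finset.univ.filter fun f : Fin n → Bool => f i ≠ f j).card =
      (Finset.univ.filter fun f : Fin n → Bool => ¬ f i ≠ f j).card := by
    refine Finset.card_nbij' (fun f => Function.update f i (!(f i)))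
      (fun f => Function.update f i (!(f i))) ?_ ?_ ?_ ?_
    · intro f hf
      simp only [Finset.coe_filter, Finset.mem_univ, true_and, Set.mem_ofPred_eq] at hf ⊢
      rw [Function.update_self, Function.update_of_ne hij.symm]
      revert hf
      cases f i <;> cases f j <;> simp
    · intro f hf
      simp only [Finset.coe_filter, Finset.mem_univ, true_and, Set.mem_ofPred_eq] at hf ⊢
      rw [Function.update_self, Function.update_of_ne hij.symm]
      revert hf
      cases f i <;> cases f j <;> simp
    · intro f _
      simp
    · intro f _
      simp
  have h := Finset.card_filter_add_card_filter_not (s := Finset.univ)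
    (fun f : Fin n → Bool => f i ≠ f j)
  rw [← hcard] at h
  simp only [Finset.card_univ, Fintype.card_fun, Fintype.card_bool, Fintype.card_fin] at h
  omega

lemma card_val_lt {N L : ℕ} (hL : L ≤ N) :
    (Finset.univ.filter fun l : Fin N => l.val < L).card = L := by
  simp [Fin.card_filter_val_lt, hL]

lemma card_blockVec_support {n N L : ℕ} (hL : L ≤ N) :
    Fintype.card {c // blockVec n N L c ≠ 0} = 2 * 2 ^ n * L := by
  have h : (Finset.univ.filter fun c : Coord n N => blockVec n N L c ≠ 0) =
      Finset.univ ×ˢ Finset.univ ×ˢ (Finset.univ.filter fun l : Fin N => l.val < L) := by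
    ext c
    simp [blockVec]
  rw [Fintype.card_subtype, h, Finset.card_product, Finset.card_product, card_val_lt hL]
  simp [mul_assoc]

lemma card_sideHalfDiff_support {n N L : ℕ} (hL : 4 * L ≤ N) (b : Bool) {i j : Fin n}
    (hij : i ≠ j) :
    Fintype.card {c // sideHalfDiff n N (4 * L) b i j c ≠ 0} = 2 * 2 ^ n * L := by
  have h : (Finset.univ.filter fun c : Coord n N => sideHalfDiff n N (4 * L) b i j c ≠ 0) =
      {b} ×ˢ (Finset.univ.filter fun f : Fin n → Bool => f i ≠ f j) ×ˢ
        (Finset.univ.filter fun l : Fin N => l.val < 4 * L) := by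
    ext c
    rw [Finset.mem_filter]
    simp only [sideHalfDiff, Finset.mem_filter, Finset.mem_univ, true_and, Finset.mem_product,
      Finset.mem_singleton]
    split_ifs with h1 h2 <;> simpa using h1
  rw [Fintype.card_subtype, h, Finset.card_product, Finset.card_product, card_val_lt hL,
    ← card_ne_eval hij, Finset.card_singleton]
  ring

/-- Doubling the scale while quartering the support multiplies the symmetrization of a kernel
satisfying the roundness inequality by at most `n / (n - 1)`. -/
lemma RoundnessIneq.symmetrization_double_le {n N L : ℕ} {R : Type*} [CommRing R] [Fintype R]
    {φ : (Coord n N → R) → (Coord n N → R) → ℝ} (hφ : RoundnessIneq n φ) (hn : 0 < n)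
    (hL : 4 * L ≤ N) (t : ℤ) :
    ((n : ℝ) - 1) * symmetrization φ ((t * 2) • blockVec n N L) ≤
      n * symmetrization φ (t • blockVec n N (4 * L)) := by
  have hside : ∀ b i j, i ≠ j →
      symmetrization φ ((t • sideVec n N (4 * L) b) j - (t • sideVec n N (4 * L) b) i) =
        symmetrization φ ((t * 2) • blockVec n N L) := by
    intro b i j hij
    rw [Pi.smul_apply, Pi.smul_apply, ← smul_sub, sideVec_sub_sideVec, smul_smul]
    refine symmetrization_smul_eq φ _ _ _ (isUnit_blockVec n N L)
      (isUnit_sideHalfDiff n N _ b i j) ?_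
    rw [card_blockVec_support (by omega), card_sideHalfDiff_support hL b hij]
  refine hφ.symmetrization_const_le hn (t • sideVec n N (4 * L) true)
    (t • sideVec n N (4 * L) false) (hside true) (hside false) fun i j => ?_
  rw [Pi.smul_apply, Pi.smul_apply, ← smul_sub]
  refine symmetrization_smul_eq φ _ _ _ (isUnit_blockVec n N _) (fun c => ?_) ?_
  · rcases sideVec_sub_cases n N (4 * L) i j c with h | h
    · exact Or.inl h.2
    · exact Or.inr h.2
  · refine Fintype.card_congr (Equiv.subtypeEquivRight fun c => ?_)
    rcases sideVec_sub_cases n N (4 * L) i j c with h | h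
    · simp [blockVec, h.1, h.2]
    · exact iff_of_true (by simp [blockVec, h.1]) h.2.ne_zero

lemma RoundnessIneq.symmetrization_pow_le {n k : ℕ} {R : Type*} [CommRing R] [Fintype R]
    {φ : (Coord n (4 ^ k) → R) → (Coord n (4 ^ k) → R) → ℝ} (hφ : RoundnessIneq n φ)
    (hn : 0 < n) (s : ℕ) (hs : s ≤ k) :
    (1 - 1 / (n : ℝ)) ^ s * symmetrization φ ((2 ^ s : ℤ) • blockVec n (4 ^ k) (4 ^ (k - s))) ≤
      symmetrization φ (blockVec n (4 ^ k) (4 ^ k)) := by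
  have hn' : (1 : ℝ) ≤ n := by exact_mod_cast hn
  have hnonneg : (0 : ℝ) ≤ 1 - 1 / n := by
    rw [sub_nonneg, div_le_one (by linarith)]
    exact hn'
  induction s with
  | zero => simp
  | succ s ih =>
    refine le_trans ?_ (ih (by omega))
    rw [pow_succ, mul_assoc]
    refine mul_le_mul_of_nonneg_left ?_ (pow_nonneg hnonneg s)
    have hpow : 4 ^ (k - s) = 4 * 4 ^ (k - (s + 1)) := by
      rw [← pow_succ']
      congr 1
      omega
    have hle : 4 * 4 ^ (k - (s + 1)) ≤ 4 ^ k := by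
      rw [← hpow]
      exact Nat.pow_le_pow_right (by norm_num) (by omega)
    have h := hφ.symmetrization_double_le hn hle (2 ^ s)
    rw [← pow_succ, ← hpow] at h
    have hn0 : (0 : ℝ) < n := by linarith
    refine le_of_mul_le_mul_left (le_trans (le_of_eq ?_) h) hn0
    field_simp

lemma half_le_one_sub_pow (k : ℕ) :
    (1 : ℝ) / 2 ≤ (1 - 1 / ((2 * k + 2 : ℕ) : ℝ)) ^ k := by
  have hpos : (0 : ℝ) < 2 * k + 2 := by positivity
  have hle : 1 / ((2 : ℝ) * k + 2) ≤ 1 := by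
    rw [div_le_one hpos]
    linarith [Nat.cast_nonneg (α := ℝ) k]
  have h := one_add_mul_le_pow (a := -(1 / ((2 : ℝ) * k + 2))) (by linarith) k
  push_cast
  rw [sub_eq_add_neg]
  refine le_trans ?_ h
  have : (k : ℝ) * (1 / (2 * k + 2)) ≤ 1 / 2 := by
    rw [mul_one_div, div_le_div_iff₀ hpos (by norm_num)]
    linarith
  linarith

/-- Pointwise bounds on a kernel satisfying the roundness inequality at the scales `1` and `2 ^ k`
are comparable. -/
lemma RoundnessIneq.le_two_mul {n k : ℕ} (hn : n = 2 * k + 2) {R : Type*} [CommRing R] [Fintype R]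
    {φ : (Coord n (4 ^ k) → R) → (Coord n (4 ^ k) → R) → ℝ}
    (hφ : RoundnessIneq n φ) {A B : ℝ}
    (hB : ∀ (z : Coord n (4 ^ k) → R) (w : Coord n (4 ^ k) → ℤ),
      (∀ c, |w c| ≤ 1) → φ z (z + fun c => (w c : R)) ≤ B)
    (hA : ∀ (z : Coord n (4 ^ k) → R) (w : Coord n (4 ^ k) → ℤ),
      (∃ c, |w c| = 2 ^ k) → A ≤ φ z (z + fun c => (w c : R))) (hA0 : 0 ≤ A) :
    A ≤ 2 * B := by
  have habs : ∀ (a : ℤˣ) (b : ℤ), |(a : ℤ) * b| = |b| := by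
    intro a b
    rw [abs_mul, Int.isUnit_iff_abs_eq.1 a.isUnit, one_mul]
  have h := hφ.symmetrization_pow_le (by omega) k le_rfl
  rw [Nat.sub_self, pow_zero] at h
  have hhalf : (1 : ℝ) / 2 ≤ (1 - 1 / (n : ℝ)) ^ k := by
    rw [hn]
    exact half_le_one_sub_pow k
  have hAB := mul_le_of_mul_symmetrization_le (A := A) (B := B) (le_trans (by norm_num) hhalf) h
    (fun σ ε z => hA _ _ ⟨σ.symm (true, fun _ => true, ⟨0, by positivity⟩), by
      rw [habs]
      simp [blockVec]⟩)
    (fun σ ε z => hB _ _ fun c => by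
      rw [habs]
      simp [blockVec])
  have := mul_le_mul_of_nonneg_right hhalf hA0
  linarith

/-- The cyclic group `ZMod m`, to be endowed with its word metric. -/
def CyclicSpace (m : ℕ) : Type := ZMod m

namespace CyclicSpace

instance (m : ℕ) : CommRing (CyclicSpace m) := inferInstanceAs (CommRing (ZMod m))

noncomputable instance (m : ℕ) [NeZero m] : Fintype (CyclicSpace m) :=
  inferInstanceAs (Fintype (ZMod m))

/-- The distance to `0` in the word metric of `ZMod m`. -/
def length {m : ℕ} (a : CyclicSpace m) : ℕ := (ZMod.valMinAbs (n := m) a).natAbs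

lemma length_eq_zero {m : ℕ} {a : CyclicSpace m} : length a = 0 ↔ a = 0 := by
  rw [length, Int.natAbs_eq_zero]
  exact ZMod.valMinAbs_eq_zero _

lemma length_neg {m : ℕ} (a : CyclicSpace m) : length (-a) = length a :=
  ZMod.natAbs_valMinAbs_neg (n := m) a

lemma length_add_le {m : ℕ} (a b : CyclicSpace m) : length (a + b) ≤ length a + length b :=
  (ZMod.natAbs_valMinAbs_add_le (n := m) a b).trans (Int.natAbs_add_le _ _)

lemma length_le {m : ℕ} [NeZero m] (a : CyclicSpace m) : length a ≤ m :=
  (ZMod.natAbs_valMinAbs_le (n := m) a).trans (Nat.div_le_self _ _)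

lemma length_intCast {m : ℕ} [NeZero m] {w : ℤ} (hw : 2 * |w| < m) :
    length (w : CyclicSpace m) = w.natAbs := by
  have h : ZMod.valMinAbs ((w : ℤ) : ZMod m) = w := by
    rw [ZMod.valMinAbs_spec]
    refine ⟨rfl, ?_, ?_⟩ <;> rcases abs_cases w with h | h <;> omega
  exact congrArg Int.natAbs h

noncomputable instance (m : ℕ) : MetricSpace (CyclicSpace m) where
  dist a b := length (b - a)
  dist_self a := by
    rw [sub_self, length_eq_zero.2 rfl, Nat.cast_zero]
  dist_comm a b := by
    rw [← length_neg, neg_sub]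
  dist_triangle a b c := by
    have h := length_add_le (b - a) (c - b)
    rw [sub_add_sub_cancel'] at h
    exact_mod_cast h
  eq_of_dist_eq_zero {a b} h := by
    have h' : length (b - a) = 0 := by exact_mod_cast h
    exact (sub_eq_zero.1 (length_eq_zero.1 h')).symm

lemma dist_def {m : ℕ} (a b : CyclicSpace m) : dist a b = length (b - a) := rfl

lemma dist_le {m : ℕ} [NeZero m] (a b : CyclicSpace m) : dist a b ≤ m := by
  rw [dist_def]
  exact_mod_cast length_le _

lemma dist_add_intCast {m : ℕ} [NeZero m] (a : CyclicSpace m) {w : ℤ} (hw : 2 * |w| < m) :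
    dist a (a + w) = |(w : ℝ)| := by
  rw [dist_def, add_sub_cancel_left, length_intCast hw, Nat.cast_natAbs, Int.cast_abs]

end CyclicSpace

section Glue

variable {M : ℕ → Type*} [∀ k, MetricSpace (M k)]

/-- The distance on a disjoint union for which points of distinct blocks `i` and `j` are at
distance `max (w i) (w j)`. -/
noncomputable def glueDist (w : ℕ → ℝ) (a b : Σ k, M k) : ℝ :=
  if h : a.1 = b.1 then dist (h ▸ a.2) b.2 else max (w a.1) (w b.1)

lemma glueDist_same (w : ℕ → ℝ) {k : ℕ} (x y : M k) :
    glueDist w ⟨k, x⟩ ⟨k, y⟩ = dist x y := by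
  simp [glueDist]

lemma glueDist_ne (w : ℕ → ℝ) {i j : ℕ} (hij : i ≠ j) (x : M i) (y : M j) :
    glueDist w ⟨i, x⟩ ⟨j, y⟩ = max (w i) (w j) := by
  simp [glueDist, hij]

/-- The disjoint union of metric spaces of diameters at most `w k`, with points of distinct
blocks `i` and `j` at distance `max (w i) (w j)`. -/
@[reducible]
noncomputable def glueMetric (w : ℕ → ℝ) (hpos : ∀ k, 0 < w k)
    (hdiam : ∀ k (x y : M k), dist x y ≤ w k) : MetricSpace (Σ k, M k) where
  dist := glueDist w
  dist_self := by
    rintro ⟨i, x⟩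
    rw [glueDist_same, dist_self]
  dist_comm := by
    rintro ⟨i, x⟩ ⟨j, y⟩
    by_cases hij : i = j
    · subst hij
      rw [glueDist_same, glueDist_same, dist_comm]
    · rw [glueDist_ne w hij, glueDist_ne w (Ne.symm hij), max_comm]
  dist_triangle := by
    rintro ⟨i, x⟩ ⟨j, y⟩ ⟨k, z⟩
    have hi := hpos i
    have hj := hpos j
    have hk := hpos k
    by_cases hij : i = j
    · subst hij
      by_cases hik : i = k
      · subst hik
        simp only [glueDist_same]
        exact dist_triangle x y z
      · rw [glueDist_ne w hik, glueDist_ne w hik, glueDist_same]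
        linarith [dist_nonneg (x := x) (y := y)]
    · rw [glueDist_ne w hij]
      by_cases hjk : j = k
      · subst hjk
        rw [glueDist_ne w hij, glueDist_same]
        linarith [dist_nonneg (x := y) (y := z)]
      · rw [glueDist_ne w hjk]
        by_cases hik : i = k
        · subst hik
          rw [glueDist_same]
          linarith [hdiam i x z, le_max_left (w i) (w j), le_max_right (w j) (w i)]
        · rw [glueDist_ne w hik]
          refine max_le ?_ ?_
          · linarith [le_max_left (w i) (w j), le_max_left (w j) (w k)]
          · linarith [le_max_left (w i) (w j), le_max_right (w j) (w k)]
  eq_of_dist_eq_zero := by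
    rintro ⟨i, x⟩ ⟨j, y⟩ h
    by_cases hij : i = j
    · subst hij
      rw [glueDist_same] at h
      rw [eq_of_dist_eq_zero h]
    · rw [glueDist_ne w hij] at h
      linarith [hpos i, le_max_left (w i) (w j)]

lemma locallyFiniteSpace_glueMetric [∀ k, Finite (M k)] (w : ℕ → ℝ) (hpos : ∀ k, 0 < w k)
    (hdiam : ∀ k (x y : M k), dist x y ≤ w k) (hw : Filter.Tendsto w Filter.atTop Filter.atTop) :
    @LocallyFiniteSpace (Σ k, M k) (glueMetric w hpos hdiam) := by
  let := glueMetric w hpos hdiam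
  intro s hs
  rcases s.eq_empty_or_nonempty with rfl | ⟨⟨i, x⟩, hx⟩
  · exact Set.finite_empty
  obtain ⟨C, hC⟩ := Metric.isBounded_iff.1 hs
  obtain ⟨K, hK⟩ := Filter.eventually_atTop.1 (hw.eventually_gt_atTop C)
  refine Set.Finite.subset ((Set.finite_Iic (max K i)).biUnion fun k _ =>
    Set.finite_range (Sigma.mk k : M k → Σ k, M k)) ?_
  rintro ⟨j, y⟩ hy
  simp only [Set.mem_iUnion, Set.mem_range]
  refine ⟨j, ?_, y, rfl⟩
  rw [Set.mem_Iic]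
  by_contra! hj
  have hne : i ≠ j := by
    rintro rfl
    exact absurd hj (not_lt.2 (le_max_right _ _))
  have h : glueDist w (⟨i, x⟩ : Σ k, M k) ⟨j, y⟩ ≤ C := hC hx hy
  rw [glueDist_ne w hne] at h
  linarith [hK j ((le_max_left K i).trans hj.le), le_max_right (w i) (w j)]

end Glue

/-- The blocks of the test space: discrete tori with the supremum metric. -/
abbrev TorusBlock (k : ℕ) : Type := Coord (2 * k + 2) (4 ^ k) → CyclicSpace (2 ^ (k + 2))

lemma dist_torusBlock_le (k : ℕ) (x y : TorusBlock k) : dist x y ≤ 2 ^ (k + 2) := by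
  rw [dist_pi_le_iff (by positivity)]
  intro c
  have h := CyclicSpace.dist_le (x c) (y c)
  exact_mod_cast h

lemma dist_torusBlock_add_le_one (k : ℕ) (z : TorusBlock k)
    (w : Coord (2 * k + 2) (4 ^ k) → ℤ) (hw : ∀ c, |w c| ≤ 1) :
    dist z (z + fun c => (w c : CyclicSpace (2 ^ (k + 2)))) ≤ 1 := by
  rw [dist_pi_le_iff zero_le_one]
  intro c
  have hlt : 2 * |w c| < ((2 ^ (k + 2) : ℕ) : ℤ) := by
    have hk : (1 : ℤ) ≤ 2 ^ k := one_le_pow₀ (by norm_num)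
    have := hw c
    push_cast
    rw [pow_add]
    linarith
  rw [Pi.add_apply, CyclicSpace.dist_add_intCast _ hlt]
  exact_mod_cast hw c

lemma pow_le_dist_torusBlock_add (k : ℕ) (z : TorusBlock k)
    (w : Coord (2 * k + 2) (4 ^ k) → ℤ) (hw : ∃ c, |w c| = 2 ^ k) :
    2 ^ k ≤ dist z (z + fun c => (w c : CyclicSpace (2 ^ (k + 2)))) := by
  obtain ⟨c, hc⟩ := hw
  have hlt : 2 * |w c| < ((2 ^ (k + 2) : ℕ) : ℤ) := by
    have hk : (1 : ℤ) ≤ 2 ^ k := one_le_pow₀ (by norm_num)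
    push_cast
    rw [pow_add, hc]
    linarith
  refine le_trans (le_of_eq ?_) (dist_le_pi_dist _ _ c)
  rw [Pi.add_apply, CyclicSpace.dist_add_intCast _ hlt]
  exact_mod_cast hc.symm

/-- A space containing coarsely every torus block, with uniform control functions, satisfies no
roundness inequality with a positive exponent. -/
lemma not_mem_grSet_of_torusBlock {X : Type*} [MetricSpace X] (f : ∀ k, TorusBlock k → X)
    {ρ₁ ρ₂ : ℝ → ℝ} (hmono : Monotone ρ₂)
    (hf : ∀ k a b, ρ₁ (dist a b) ≤ dist (f k a) (f k b) ∧ dist (f k a) (f k b) ≤ ρ₂ (dist a b))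
    (hmono₁ : Monotone ρ₁) (hρ₁ : Filter.Tendsto ρ₁ Filter.atTop Filter.atTop) {p : ℝ}
    (hp : 0 < p) : p ∉ grSet (dist : X → X → ℝ) := by
  intro hpX
  have hbound : ∀ k : ℕ, 0 ≤ ρ₁ (2 ^ k) → ρ₁ (2 ^ k) ^ p ≤ 2 * ρ₂ 1 ^ p := by
    intro k hk
    have hround : RoundnessIneq (2 * k + 2) fun a b : TorusBlock k => dist (f k a) (f k b) ^ p :=
      fun x y => hpX.2 _ (by omega) (fun i => f k (x i)) (fun i => f k (y i))
    refine hround.le_two_mul rfl (fun z w hw => ?_) (fun z w hw => ?_) (Real.rpow_nonneg hk p)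
    · exact Real.rpow_le_rpow dist_nonneg ((hf k _ _).2.trans
        (hmono (dist_torusBlock_add_le_one k z w hw))) hp.le
    · exact Real.rpow_le_rpow hk ((hmono₁ (pow_le_dist_torusBlock_add k z w hw)).trans
        (hf k _ _).1) hp.le
  have hlim : Filter.Tendsto (fun k : ℕ => ρ₁ (2 ^ k)) Filter.atTop Filter.atTop :=
    hρ₁.comp (tendsto_pow_atTop_atTop_of_one_lt one_lt_two)
  obtain ⟨k, hk, hk'⟩ := ((((tendsto_rpow_atTop hp).comp hlim).eventually_gt_atTop
    (2 * ρ₂ 1 ^ p)).and (hlim.eventually_ge_atTop 0)).exists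
  exact absurd (hbound k hk') (not_le.2 hk)

lemma LocallyFiniteSpace.uLift {Z : Type*} [MetricSpace Z] (hZ : LocallyFiniteSpace Z) :
    LocallyFiniteSpace (ULift Z) := by
  intro s hs
  refine Set.Finite.of_finite_image (hZ (ULift.down '' s) ?_) ULift.down_injective.injOn
  obtain ⟨C, hC⟩ := Metric.isBounded_iff.1 hs
  refine Metric.isBounded_iff.2 ⟨C, ?_⟩
  rintro _ ⟨a, ha, rfl⟩ _ ⟨b, hb, rfl⟩
  exact hC ha hb

/-- Corollary 1 of the paper: no universal coarse embedding space has
non zero generalized roundness: if every locally finite metric space coarsely embeds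
into `X`, then `𝔮(X) = 0`. -/
theorem universal_coarse_embedding_space_zero_roundness {X : Type*} [MetricSpace X]
    (h : ∀ (Z : Type*) [MetricSpace Z], LocallyFiniteSpace Z →
      ∃ f : Z → X, IsCoarseEmbeddingWith (dist : Z → Z → ℝ) (dist : X → X → ℝ) f) :
    genRoundness (dist : X → X → ℝ) = 0 := by
  let w : ℕ → ℝ := fun k => 2 ^ (k + 2)
  have hpos : ∀ k, 0 < w k := fun k => by positivity
  let : MetricSpace (Σ k, TorusBlock k) := glueMetric w hpos dist_torusBlock_le
  have hw : Filter.Tendsto w Filter.atTop Filter.atTop :=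
    (tendsto_pow_atTop_atTop_of_one_lt one_lt_two).comp (Filter.tendsto_add_atTop_nat 2)
  have hZ : LocallyFiniteSpace (Σ k, TorusBlock k) :=
    locallyFiniteSpace_glueMetric w hpos dist_torusBlock_le hw
  obtain ⟨f, ρ₁, ρ₂, hρ₁, hρ₂, hf, hlim⟩ := h (ULift (Σ k, TorusBlock k)) hZ.uLift
  rw [genRoundness, ← bot_eq_zero, sSup_eq_bot]
  rintro _ ⟨p, hp, rfl⟩
  rw [bot_eq_zero, ENNReal.ofReal_eq_zero]
  by_contra! hp0
  refine not_mem_grSet_of_torusBlock (fun k x => f ⟨k, x⟩) hρ₂ (fun k a b => ?_) hρ₁ hlim hp0 hp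
  have hd : dist (ULift.up (⟨k, a⟩ : Σ k, TorusBlock k)) (ULift.up ⟨k, b⟩) = dist a b :=
    glueDist_same w a b
  rw [← hd]
  exact hf _ _
end

section
/- For 0 < p ≤ 2, no metric subspace of an L_p(μ)-space is a universal coarse embedding space, and no ultrametric space is a universal coarse embedding space: there exists a locally finite metric space that does not coarsely embed into any such space. -/
/-- The distance function of a metric space. -/
def distOf (Z : Type*) [MetricSpace Z] : Z → Z → ℝ := dist

/-- A metric space `Y` is (isometric to) a metric subspace of an `L_p(μ)`-space:
there is a measure `μ` on some `α` and a map `ι` of `Y` into (`μ`-measurable) real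
valued functions on `α` such that the distance in `Y` is the `L_p`-distance
`(∫ |ι a − ι b|^p dμ)^{min(1, 1/p)}` (the exponent `min 1 p⁻¹` being `1` for `p ≤ 1`
and `1/p` for `p ≥ 1`). -/
def IsLpSubspace (p : ℝ) (Y : Type*) [MetricSpace Y] : Prop :=
  ∃ (α : Type) (mα : MeasurableSpace α) (μ : @MeasureTheory.Measure α mα)
    (ι : Y → α → ℝ), (∀ a : Y, @Measurable α ℝ mα _ (ι a)) ∧
      ∀ a b : Y, dist a b =
        (@MeasureTheory.lintegral α mα μ
            (fun x => ENNReal.ofReal (|ι a x - ι b x| ^ p))).toReal ^ (min 1 p⁻¹)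

/-- A metric space is an ultrametric space if it satisfies the strong triangle
inequality. -/
def IsUltrametricSpace (Y : Type*) [MetricSpace Y] : Prop :=
  ∀ a b c : Y, dist a c ≤ max (dist a b) (dist b c)

section Cotype
open Finset
variable {G ι : Type*} [AddCommGroup G] [Fintype ι] [DecidableEq ι]

/-- The signed sum `∑ i, ε i • e i` of a family `e` in an abelian group. -/
def signedSum (e : ι → G) (ε : ι → ℤˣ) : G := ∑ i, (ε i : ℤ) • e i

theorem signedSum_flip (e : ι → G) (ε : ι → ℤˣ) (j : ι) :
    signedSum e (ε * Pi.mulSingle j (-1)) = signedSum e ε - (2 * (ε j : ℤ)) • e j := by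
  unfold signedSum
  rw [← Finset.add_sum_erase _ _ (mem_univ j),
    ← Finset.add_sum_erase _ (fun i => (ε i : ℤ) • e i) (mem_univ j)]
  have h : ∑ i ∈ univ.erase j, (((ε * Pi.mulSingle j (-1) : ι → ℤˣ) i : ℤˣ) : ℤ) • e i =
      ∑ i ∈ univ.erase j, (ε i : ℤ) • e i :=
    Finset.sum_congr rfl fun i hi => by simp [Finset.ne_of_mem_erase hi]
  rw [h]
  simp only [Pi.mul_apply, Pi.mulSingle_eq_same, mul_neg, mul_one, Units.val_neg, neg_smul,
    two_mul, add_smul]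
  abel

/-- The value of a sign as a real number. -/
def signVal (u : ℤˣ) : ℝ := ((u : ℤ) : ℝ)

theorem signVal_mul_self (u : ℤˣ) : signVal u * signVal u = 1 := by
  rcases Int.units_eq_one_or u with rfl | rfl <;> simp [signVal]

theorem sum_sign_flip (j : ι) (h : (ι → ℤˣ) → ℝ) :
    ∑ ε : ι → ℤˣ, h (ε * Pi.mulSingle j (-1)) = ∑ ε, h ε :=
  Equiv.sum_comp (Equiv.mulRight (Pi.mulSingle j (-1) : ι → ℤˣ)) h

theorem sum_signVal (j : ι) : ∑ ε : ι → ℤˣ, signVal (ε j) = 0 := by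
  have h := sum_sign_flip j fun ε => signVal (ε j)
  simp only [Pi.mul_apply, Pi.mulSingle_eq_same, mul_neg, mul_one, signVal, Units.val_neg,
    Int.cast_neg, sum_neg_distrib] at h
  simp only [signVal]
  linarith

theorem sum_signVal_mul (i j : ι) :
    ∑ ε : ι → ℤˣ, signVal (ε i) * signVal (ε j) =
      if i = j then (Fintype.card (ι → ℤˣ) : ℝ) else 0 := by
  split_ifs with hij
  · subst hij
    simp only [signVal_mul_self, sum_const, card_univ, nsmul_eq_mul, mul_one]
  · have h := sum_sign_flip j fun ε => signVal (ε i) * signVal (ε j)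
    simp only [Pi.mul_apply, Pi.mulSingle_eq_same, Pi.mulSingle_eq_of_ne hij, mul_neg, mul_one,
      signVal, Units.val_neg, Int.cast_neg, sum_neg_distrib] at h
    simp only [signVal]
    linarith

/-- Bessel's inequality for the Rademacher system. -/
theorem sum_sq_rademacher_le (h : (ι → ℤˣ) → ℝ) :
    ∑ j, (∑ ε, signVal (ε j) * h ε) ^ 2 ≤ (Fintype.card (ι → ℤˣ) : ℝ) * ∑ ε, h ε ^ 2 := by
  set N : ℝ := (Fintype.card (ι → ℤˣ) : ℝ) with hN
  have hNpos : 0 < N := by rw [hN]; exact_mod_cast Fintype.card_pos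
  set D : ι → ℝ := fun j => ∑ ε, signVal (ε j) * h ε with hD
  have h0 : 0 ≤ ∑ ε, (N * h ε - ∑ j, D j * signVal (ε j)) ^ 2 :=
    Finset.sum_nonneg fun _ _ => sq_nonneg _
  have h1 : ∑ ε, h ε * ∑ j, D j * signVal (ε j) = ∑ j, D j ^ 2 := by
    simp_rw [Finset.mul_sum]
    rw [Finset.sum_comm]
    refine Finset.sum_congr rfl fun j _ => ?_
    rw [sq]
    change _ = (∑ ε, signVal (ε j) * h ε) * D j
    rw [Finset.sum_mul]
    exact Finset.sum_congr rfl fun ε _ => by ring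
  have h2 : ∑ ε : ι → ℤˣ, (∑ j, D j * signVal (ε j)) ^ 2 = N * ∑ j, D j ^ 2 := by
    simp_rw [sq, Finset.sum_mul_sum]
    rw [Finset.sum_comm, Finset.mul_sum]
    refine Finset.sum_congr rfl fun i _ => ?_
    rw [Finset.sum_comm]
    have : ∀ j, ∑ ε : ι → ℤˣ, D i * signVal (ε i) * (D j * signVal (ε j)) =
        D i * D j * if i = j then N else 0 := fun j => by
      rw [hN, ← sum_signVal_mul i j, Finset.mul_sum]
      exact Finset.sum_congr rfl fun ε _ => by ring
    simp_rw [this]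
    simp
    ring
  have h3 : ∑ ε, (N * h ε - ∑ j, D j * signVal (ε j)) ^ 2 =
      N ^ 2 * ∑ ε, h ε ^ 2 - 2 * N * ∑ ε, h ε * ∑ j, D j * signVal (ε j) +
        ∑ ε : ι → ℤˣ, (∑ j, D j * signVal (ε j)) ^ 2 := by
    simp_rw [Finset.mul_sum, ← Finset.sum_sub_distrib, ← Finset.sum_add_distrib]
    refine Finset.sum_congr rfl fun ε _ => ?_
    rw [← Finset.mul_sum, ← Finset.mul_sum]
    ring
  rw [h3, h1, h2] at h0
  have : 0 ≤ N * (N * ∑ ε, h ε ^ 2 - ∑ j, D j ^ 2) := by linarith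
  have := nonneg_of_mul_nonneg_right this hNpos
  linarith

/-- Averaging over the half of the signs with `ε j = 1`, up to normalisation. -/
def halfSum (e : ι → G) (F : G → ℝ) (j : ι) (x : G) : ℝ :=
  ∑ ε : ι → ℤˣ, (1 + signVal (ε j)) * F (x + signedSum e ε)

theorem halfSum_step (e : ι → G) (F : G → ℝ) (j : ι) (x : G) :
    halfSum e F j (x + (2 : ℤ) • e j) - halfSum e F j x =
      2 * ∑ ε : ι → ℤˣ, signVal (ε j) * F (x + (2 : ℤ) • e j + signedSum e ε) := by
  have key : halfSum e F j x =
      ∑ ε : ι → ℤˣ, (1 - signVal (ε j)) * F (x + (2 : ℤ) • e j + signedSum e ε) := by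
    unfold halfSum
    rw [← sum_sign_flip j]
    refine Finset.sum_congr rfl fun ε _ => ?_
    rw [signedSum_flip]
    rcases Int.units_eq_one_or (ε j) with h | h
    · simp [h, signVal]
    · simp only [Pi.mul_apply, Pi.mulSingle_eq_same, h, signVal]
      simp only [mul_neg, mul_one, neg_neg, Units.val_neg, Units.val_one, Int.cast_neg,
        Int.cast_one, neg_smul, sub_neg_eq_add]
      congr 2
      abel
  rw [key]
  unfold halfSum
  rw [← Finset.sum_sub_distrib, Finset.mul_sum]
  exact Finset.sum_congr rfl fun ε _ => by ring

theorem halfSum_telescope (e : ι → G) (F : G → ℝ) (j : ι) (x : G) (m : ℕ) :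
    halfSum e F j (x + (2 * m : ℤ) • e j) - halfSum e F j x =
      2 * ∑ s ∈ range m, ∑ ε : ι → ℤˣ,
        signVal (ε j) * F (x + (2 * (s + 1) : ℤ) • e j + signedSum e ε) := by
  induction m with
  | zero => simp
  | succ m ih =>
    rw [Finset.sum_range_succ, mul_add, ← ih]
    have h := halfSum_step e F j (x + (2 * m : ℤ) • e j)
    have h' : x + (2 * m : ℤ) • e j + (2 : ℤ) • e j = x + (2 * (m + 1) : ℤ) • e j := by
      rw [add_assoc, ← add_smul, mul_add, mul_one]
    rw [h'] at h
    push_cast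
    rw [← h]
    ring

theorem sum_add_right_comp [Fintype G] (F : G → ℝ) (a : G) : ∑ x, F (x + a) = ∑ x, F x :=
  Equiv.sum_comp (Equiv.addRight a) F

theorem abs_signVal (u : ℤˣ) : |signVal u| = 1 := by
  rcases Int.units_eq_one_or u with rfl | rfl <;> simp [signVal]

theorem sq_halfSum_sub_le (e : ι → G) (F : G → ℝ) (j : ι) (x : G) :
    (halfSum e F j x - (Fintype.card (ι → ℤˣ) : ℝ) * F x) ^ 2 ≤
      4 * (Fintype.card (ι → ℤˣ) : ℝ) * ∑ ε, (F (x + signedSum e ε) - F x) ^ 2 := by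
  have h : halfSum e F j x - (Fintype.card (ι → ℤˣ) : ℝ) * F x =
      ∑ ε : ι → ℤˣ, (1 + signVal (ε j)) * (F (x + signedSum e ε) - F x) := by
    simp_rw [mul_sub, Finset.sum_sub_distrib, ← Finset.sum_mul, Finset.sum_add_distrib,
      sum_signVal]
    simp [halfSum]
  rw [h]
  refine (Finset.sum_mul_sq_le_sq_mul_sq _ _ _).trans ?_
  refine mul_le_mul_of_nonneg_right ?_ (Finset.sum_nonneg fun _ _ => sq_nonneg _)
  refine (Finset.sum_le_card_nsmul univ _ 4 fun ε _ => ?_).trans ?_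
  · have := signVal_mul_self (ε j)
    have := abs_le.1 (abs_signVal (ε j)).le
    nlinarith
  · rw [nsmul_eq_mul, card_univ, mul_comm]

/-- The metric cotype 2 inequality of the real line, on a finite abelian group. -/
theorem metric_cotype_real [Fintype G] (e : ι → G) (F : G → ℝ) (m : ℕ) :
    (Fintype.card (ι → ℤˣ) : ℝ) * ∑ j, ∑ x, (F (x + (2 * m : ℤ) • e j) - F x) ^ 2 ≤
      24 * (Fintype.card ι + m ^ 2 : ℝ) *
        ∑ x, ∑ ε : ι → ℤˣ, (F (x + signedSum e ε) - F x) ^ 2 := by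
  set N : ℝ := (Fintype.card (ι → ℤˣ) : ℝ) with hN
  have hNpos : 0 < N := by rw [hN]; exact_mod_cast Fintype.card_pos
  set S := ∑ x, ∑ ε : ι → ℤˣ, (F (x + signedSum e ε) - F x) ^ 2 with hS
  let D : ι → G → ℝ := fun j x => ∑ ε : ι → ℤˣ, signVal (ε j) * F (x + signedSum e ε)
  have hD : ∑ j, ∑ x, D j x ^ 2 ≤ N * S := by
    rw [Finset.sum_comm, hS, Finset.mul_sum]
    refine Finset.sum_le_sum fun x _ => ?_
    refine le_trans (le_of_eq ?_) (sum_sq_rademacher_le fun ε => F (x + signedSum e ε) - F x)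
    refine Finset.sum_congr rfl fun j _ => ?_
    simp only [D, mul_sub, Finset.sum_sub_distrib, ← Finset.sum_mul, sum_signVal, zero_mul,
      sub_zero]
  have hP : ∀ j, ∑ x, (halfSum e F j x - N * F x) ^ 2 ≤ 4 * N * S := fun j => by
    rw [hS, Finset.mul_sum]
    exact Finset.sum_le_sum fun x _ => sq_halfSum_sub_le e F j x
  have hT : ∀ j, ∑ x, (halfSum e F j (x + (2 * m : ℤ) • e j) - halfSum e F j x) ^ 2 ≤
      4 * (m : ℝ) ^ 2 * ∑ x, D j x ^ 2 := fun j => by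
    have h : ∀ x, (halfSum e F j (x + (2 * m : ℤ) • e j) - halfSum e F j x) ^ 2 ≤
        4 * m * ∑ s ∈ range m, D j (x + (2 * (s + 1) : ℤ) • e j) ^ 2 := fun x => by
      rw [halfSum_telescope, mul_pow]
      have := sq_sum_le_card_mul_sum_sq (s := range m)
        (f := fun s : ℕ => D j (x + (2 * (s + 1) : ℤ) • e j))
      rw [card_range] at this
      simp only [D] at this ⊢
      linarith
    refine (Finset.sum_le_sum fun x _ => h x).trans (le_of_eq ?_)
    rw [← Finset.mul_sum, Finset.sum_comm]
    simp_rw [sum_add_right_comp (fun x => D j x ^ 2)]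
    rw [sum_const, card_range, nsmul_eq_mul]
    ring
  have hj : ∀ j, N ^ 2 * ∑ x, (F (x + (2 * m : ℤ) • e j) - F x) ^ 2 ≤
      24 * N * S + 12 * (m : ℝ) ^ 2 * ∑ x, D j x ^ 2 := fun j => by
    have h1 : N ^ 2 * ∑ x, (F (x + (2 * m : ℤ) • e j) - F x) ^ 2 ≤
        ∑ x, 3 * ((halfSum e F j (x + (2 * m : ℤ) • e j) - N * F (x + (2 * m : ℤ) • e j)) ^ 2 +
          (halfSum e F j x - N * F x) ^ 2 +
          (halfSum e F j (x + (2 * m : ℤ) • e j) - halfSum e F j x) ^ 2) := by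
      rw [Finset.mul_sum]
      refine Finset.sum_le_sum fun x _ => ?_
      generalize halfSum e F j (x + (2 * m : ℤ) • e j) = a
      generalize halfSum e F j x = b
      generalize F (x + (2 * m : ℤ) • e j) = c
      generalize F x = d
      nlinarith [sq_nonneg ((a - N * c) - (b - N * d)),
        sq_nonneg ((a - N * c) + (b - N * d)), sq_nonneg ((a - N * c) + (a - b)),
        sq_nonneg ((b - N * d) - (a - b))]
    rw [← Finset.mul_sum, Finset.sum_add_distrib, Finset.sum_add_distrib,
      sum_add_right_comp (fun x => (halfSum e F j x - N * F x) ^ 2)] at h1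
    linarith [hP j, hT j]
  have hsum := Finset.sum_le_sum fun j (_ : j ∈ univ) => hj j
  rw [← Finset.mul_sum, Finset.sum_add_distrib, sum_const, card_univ,
    nsmul_eq_mul, ← Finset.mul_sum] at hsum
  have hm : 12 * (m : ℝ) ^ 2 * ∑ j, ∑ x, D j x ^ 2 ≤ 12 * (m : ℝ) ^ 2 * (N * S) :=
    mul_le_mul_of_nonneg_left hD (by positivity)
  have hS0 : 0 ≤ S := Finset.sum_nonneg fun _ _ => Finset.sum_nonneg fun _ _ => sq_nonneg _
  have hmS : 0 ≤ (m : ℝ) ^ 2 * (N * S) := by positivity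
  refine le_of_mul_le_mul_left ?_ hNpos
  calc _ = N ^ 2 * ∑ j, ∑ x, (F (x + (2 * m : ℤ) • e j) - F x) ^ 2 := by ring
    _ ≤ _ := by linarith

end Cotype

section CotypeKernel
open Finset MeasureTheory
variable {G ι : Type*} [AddCommGroup G] [Fintype G] [Fintype ι] [DecidableEq ι]

/-- The metric cotype 2 inequality for a kernel `ψ` playing the role of a squared distance. -/
def CotypeInequality (e : ι → G) (m : ℕ) (ψ : G → G → ℝ) : Prop :=
  (Fintype.card (ι → ℤˣ) : ℝ) * ∑ j, ∑ x, ψ (x + (2 * m : ℤ) • e j) x ≤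
    24 * (Fintype.card ι + m ^ 2 : ℝ) * ∑ x, ∑ ε : ι → ℤˣ, ψ (x + signedSum e ε) x

theorem CotypeInequality.integral {Ω : Type*} [MeasurableSpace Ω] {μ : Measure Ω}
    {e : ι → G} {m : ℕ} {K : Ω → G → G → ℝ} (hK : ∀ᵐ w ∂μ, CotypeInequality e m (K w))
    (hint : ∀ x y, Integrable (fun w => K w x y) μ) :
    CotypeInequality e m fun x y => ∫ w, K w x y ∂μ := by
  unfold CotypeInequality at hK ⊢
  have hl : ∀ j, Integrable (fun w => ∑ x, K w (x + (2 * m : ℤ) • e j) x) μ := fun j =>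
    integrable_finsetSum _ fun x _ => hint _ _
  have hr : ∀ x, Integrable (fun w => ∑ ε : ι → ℤˣ, K w (x + signedSum e ε) x) μ := fun x =>
    integrable_finsetSum _ fun ε _ => hint _ _
  have h := integral_mono_ae ((integrable_finsetSum univ fun j _ => hl j).const_mul _)
    ((integrable_finsetSum univ fun x _ => hr x).const_mul _) hK
  rw [integral_const_mul, integral_const_mul, integral_finsetSum _ fun j _ => hl j,
    integral_finsetSum _ fun x _ => hr x] at h
  simpa only [integral_finsetSum _ fun _ _ => hint _ _] using h

theorem CotypeInequality.add {e : ι → G} {m : ℕ} {ψ φ : G → G → ℝ}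
    (hψ : CotypeInequality e m ψ) (hφ : CotypeInequality e m φ) :
    CotypeInequality e m fun x y => ψ x y + φ x y := by
  unfold CotypeInequality at *
  simp_rw [Finset.sum_add_distrib, mul_add]
  linarith

theorem CotypeInequality.const_mul {e : ι → G} {m : ℕ} {ψ : G → G → ℝ}
    (hψ : CotypeInequality e m ψ) {c : ℝ} (hc : 0 ≤ c) :
    CotypeInequality e m fun x y => c * ψ x y := by
  unfold CotypeInequality at *
  simp_rw [← Finset.mul_sum, mul_left_comm _ c]
  exact mul_le_mul_of_nonneg_left hψ hc

theorem cotypeInequality_sq (e : ι → G) (m : ℕ) (F : G → ℝ) :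
    CotypeInequality e m fun x y => (F x - F y) ^ 2 :=
  metric_cotype_real e F m

theorem cotypeInequality_one_sub_cos (e : ι → G) (m : ℕ) (F : G → ℝ) :
    CotypeInequality e m fun x y => 1 - Real.cos (F x - F y) := by
  have h := ((cotypeInequality_sq e m fun x => Real.cos (F x)).add
    (cotypeInequality_sq e m fun x => Real.sin (F x))).const_mul (c := 1 / 2) (by norm_num)
  convert h using 3 with x y
  rw [Real.cos_sub]
  linarith [Real.sin_sq_add_cos_sq (F x), Real.sin_sq_add_cos_sq (F y)]

theorem integrableOn_one_sub_cos_mul_rpow {p : ℝ} (hp : 0 < p) (hp2 : p < 2) (s : ℝ) :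
    IntegrableOn (fun u : ℝ => (1 - Real.cos (u * s)) * u ^ (-1 - p)) (Set.Ioi 0) := by
  have hmeas : Measurable fun u : ℝ => (1 - Real.cos (u * s)) * u ^ (-1 - p) := by fun_prop
  rw [← Set.Ioc_union_Ioi_eq_Ioi zero_le_one]
  refine IntegrableOn.union ?_ ?_
  · have h : IntegrableOn (fun u : ℝ => s ^ 2 / 2 * u ^ (1 - p)) (Set.Ioc 0 1) :=
      ((intervalIntegrable_iff_integrableOn_Ioc_of_le zero_le_one).1
        (intervalIntegral.intervalIntegrable_rpow' (by linarith))).const_mul _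
    refine h.mono' hmeas.aestronglyMeasurable ?_
    filter_upwards [ae_restrict_mem measurableSet_Ioc] with u hu
    have hu0 : 0 < u := hu.1
    have h1 : 0 ≤ 1 - Real.cos (u * s) := by linarith [Real.cos_le_one (u * s)]
    have h2 : 1 - Real.cos (u * s) ≤ (u * s) ^ 2 / 2 := by
      linarith [Real.one_sub_sq_div_two_le_cos (x := u * s)]
    rw [Real.norm_of_nonneg (by positivity)]
    calc _ ≤ (u * s) ^ 2 / 2 * u ^ (-1 - p) := by gcongr
      _ = s ^ 2 / 2 * (u ^ (2 : ℝ) * u ^ (-1 - p)) := by rw [Real.rpow_two]; ring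
      _ = _ := by rw [← Real.rpow_add hu0]; ring_nf
  · have h : IntegrableOn (fun u : ℝ => 2 * u ^ (-1 - p)) (Set.Ioi 1) :=
      (integrableOn_Ioi_rpow_of_lt (by linarith) one_pos).const_mul _
    refine h.mono' hmeas.aestronglyMeasurable ?_
    filter_upwards [ae_restrict_mem measurableSet_Ioi] with u hu
    have hu0 : 0 < u := one_pos.trans hu
    have h1 : 0 ≤ 1 - Real.cos (u * s) := by linarith [Real.cos_le_one (u * s)]
    rw [Real.norm_of_nonneg (by positivity)]
    gcongr
    linarith [Real.neg_one_le_cos (u * s)]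

theorem integral_one_sub_cos_mul_rpow {p : ℝ} (hp : 0 < p) (s : ℝ) :
    ∫ u in Set.Ioi (0 : ℝ), (1 - Real.cos (u * s)) * u ^ (-1 - p) =
      |s| ^ p * ∫ u in Set.Ioi (0 : ℝ), (1 - Real.cos u) * u ^ (-1 - p) := by
  rcases eq_or_ne s 0 with rfl | hs
  · simp [Real.zero_rpow hp.ne']
  have hs' : 0 < |s| := abs_pos.2 hs
  have h := integral_comp_mul_left_Ioi' (fun u : ℝ => (1 - Real.cos u) * u ^ (-1 - p)) 0 hs'
  rw [mul_zero] at h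
  rw [← h, smul_eq_mul, ← mul_assoc, ← integral_const_mul]
  refine setIntegral_congr_fun measurableSet_Ioi fun u hu => ?_
  have hu0 : 0 < u := hu
  have hc : Real.cos (|s| * u) = Real.cos (u * s) := by
    rw [← Real.cos_abs (u * s), abs_mul, abs_of_pos hu0, mul_comm]
  have hpow : |s| ^ p * |s| * |s| ^ (-1 - p) = 1 := by
    rw [← Real.rpow_add_one hs'.ne', ← Real.rpow_add hs']
    ring_nf
    exact Real.rpow_zero _
  rw [hc, Real.mul_rpow hs'.le hu0.le]
  linear_combination -(1 - Real.cos (u * s)) * u ^ (-1 - p) * hpow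

theorem integral_one_sub_cos_mul_rpow_pos {p : ℝ} (hp : 0 < p) (hp2 : p < 2) :
    0 < ∫ u in Set.Ioi (0 : ℝ), (1 - Real.cos u) * u ^ (-1 - p) := by
  have hi := integrableOn_one_sub_cos_mul_rpow hp hp2 1
  simp only [mul_one] at hi
  have hnn : ∀ u ∈ Set.Ioi (0 : ℝ), 0 ≤ (1 - Real.cos u) * u ^ (-1 - p) := fun u hu =>
    mul_nonneg (by linarith [Real.cos_le_one u]) (Real.rpow_nonneg (le_of_lt hu) _)
  rw [setIntegral_pos_iff_support_of_nonneg_ae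
    ((ae_restrict_mem measurableSet_Ioi).mono hnn) hi]
  refine lt_of_lt_of_le ?_ (measure_mono (s := Set.Ioo (0 : ℝ) 1) fun u hu => ⟨?_, hu.1⟩)
  · simp
  · have : Real.cos u < 1 := by
      rw [← Real.cos_zero]
      exact Real.cos_lt_cos_of_nonneg_of_le_pi le_rfl
        (hu.2.le.trans (by linarith [Real.pi_gt_three])) hu.1
    exact mul_ne_zero (by linarith) (Real.rpow_pos_of_pos hu.1 _).ne'

theorem cotypeInequality_rpow {p : ℝ} (hp : 0 < p) (hp2 : p ≤ 2) (e : ι → G) (m : ℕ)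
    (F : G → ℝ) : CotypeInequality e m fun x y => |F x - F y| ^ p := by
  rcases hp2.eq_or_lt with rfl | hp2
  · simpa only [Real.rpow_two, sq_abs] using cotypeInequality_sq e m F
  set C := ∫ u in Set.Ioi (0 : ℝ), (1 - Real.cos u) * u ^ (-1 - p) with hC
  have hCpos : 0 < C := integral_one_sub_cos_mul_rpow_pos hp hp2
  have h : CotypeInequality e m fun x y =>
      ∫ u in Set.Ioi (0 : ℝ), (1 - Real.cos (u * (F x - F y))) * u ^ (-1 - p) := by
    refine CotypeInequality.integral
      (K := fun u x y => (1 - Real.cos (u * (F x - F y))) * u ^ (-1 - p)) ?_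
      fun x y => integrableOn_one_sub_cos_mul_rpow hp hp2 _
    filter_upwards [ae_restrict_mem measurableSet_Ioi] with u hu
    have := (cotypeInequality_one_sub_cos e m fun x => u * F x).const_mul
      (Real.rpow_nonneg (le_of_lt hu) (-1 - p))
    simpa only [mul_sub, mul_comm (u ^ (-1 - p))] using this
  simp_rw [integral_one_sub_cos_mul_rpow hp, ← hC] at h
  have := h.const_mul (inv_nonneg.2 hCpos.le)
  convert this using 3
  field_simp

/-- In a metric subspace of an `L_p`-space, `0 < p ≤ 2`, a power of the distance satisfies the
metric cotype 2 inequality. -/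
theorem IsLpSubspace.cotypeInequality {p : ℝ} (hp : 0 < p) (hp2 : p ≤ 2) {Y : Type*}
    [MetricSpace Y] (hY : IsLpSubspace p Y) (e : ι → G) (m : ℕ) (f : G → Y) :
    CotypeInequality e m fun x y => dist (f x) (f y) ^ (max 1 p) := by
  obtain ⟨α, mα, μ, φ, hφ, hd⟩ := hY
  have hmeas : ∀ a b, Measurable fun w => |φ a w - φ b w| ^ p := fun a b =>
    (((hφ a).sub (hφ b)).abs).pow_const p
  have hnn : ∀ a b w, 0 ≤ |φ a w - φ b w| ^ p := fun a b w => by positivity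
  have hmin : 0 < min 1 p⁻¹ := lt_min one_pos (inv_pos.2 hp)
  have hmm : min 1 p⁻¹ * max 1 p = 1 := by
    rcases le_total 1 p with h | h
    · rw [max_eq_right h, min_eq_right (inv_le_one_of_one_le₀ h), inv_mul_cancel₀ hp.ne']
    · rw [max_eq_left h, min_eq_left ((one_le_inv₀ hp).2 h), mul_one]
  have hfin : ∀ a b, ∫⁻ w, ENNReal.ofReal (|φ a w - φ b w| ^ p) ∂μ ≠ ⊤ := fun a b htop => by
    have h0 : dist a b = 0 := by
      rw [hd, htop, ENNReal.toReal_top, Real.zero_rpow hmin.ne']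
    rw [dist_eq_zero] at h0
    subst h0
    simp [Real.zero_rpow hp.ne'] at htop
  have hint : ∀ a b, Integrable (fun w => |φ a w - φ b w| ^ p) μ := fun a b =>
    (lintegral_ofReal_ne_top_iff_integrable (hmeas a b).aestronglyMeasurable
      (Filter.Eventually.of_forall (hnn a b))).1 (hfin a b)
  have heq : ∀ a b, dist a b ^ (max 1 p) = ∫ w, |φ a w - φ b w| ^ p ∂μ := fun a b => by
    rw [hd, ← Real.rpow_mul ENNReal.toReal_nonneg, hmm, Real.rpow_one,
      integral_eq_lintegral_of_nonneg_ae (Filter.Eventually.of_forall (hnn a b))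
        (hmeas a b).aestronglyMeasurable]
  simp_rw [heq]
  exact CotypeInequality.integral (K := fun w x y => |φ (f x) w - φ (f y) w| ^ p)
    (Filter.Eventually.of_forall fun w => cotypeInequality_rpow hp hp2 e m fun x => φ (f x) w)
    fun x y => hint _ _

/-- The cotype inequality bounds long displacements by short ones when the number of
directions is the square of the length. -/
theorem CotypeInequality.le_of_card_eq {e : ι → G} {m : ℕ} {ψ : G → G → ℝ}
    (h : CotypeInequality e m ψ) (hm : m ≠ 0) (hcard : Fintype.card ι = m ^ 2) {A B : ℝ}
    (hA : ∀ j x, A ≤ ψ (x + (2 * m : ℤ) • e j) x)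
    (hB : ∀ (ε : ι → ℤˣ) x, ψ (x + signedSum e ε) x ≤ B) : A ≤ 48 * B := by
  unfold CotypeInequality at h
  have h1 : ((m : ℝ) ^ 2 * (Fintype.card G * A)) ≤ ∑ j, ∑ x, ψ (x + (2 * m : ℤ) • e j) x := by
    have := Finset.sum_le_sum fun j (_ : j ∈ univ) =>
      Finset.sum_le_sum fun x (_ : x ∈ univ) => hA j x
    simpa [hcard] using this
  have h2 : ∑ x, ∑ ε : ι → ℤˣ, ψ (x + signedSum e ε) x ≤
      Fintype.card G * ((Fintype.card (ι → ℤˣ) : ℝ) * B) := by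
    have := Finset.sum_le_sum fun x (_ : x ∈ univ) =>
      Finset.sum_le_sum fun ε (_ : ε ∈ univ) => hB ε x
    simpa only [sum_const, card_univ, nsmul_eq_mul] using this
  have hN : (0 : ℝ) < Fintype.card (ι → ℤˣ) := by exact_mod_cast Fintype.card_pos
  have hG : (0 : ℝ) < Fintype.card G := by exact_mod_cast Fintype.card_pos
  have hm' : (0 : ℝ) < (m : ℝ) ^ 2 := by positivity
  have h3 := (mul_le_mul_of_nonneg_left h1 hN.le).trans
    (h.trans (mul_le_mul_of_nonneg_left h2 (by positivity)))
  rw [hcard] at h3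
  push_cast at h3
  have hpos : 0 < (Fintype.card (ι → ℤˣ) : ℝ) * m ^ 2 * Fintype.card G := by positivity
  refine le_of_mul_le_mul_left ?_ hpos
  linarith

end CotypeKernel

section Torus
open Finset

/-- The discrete torus `(ℤ / 4(m+1))^((m+1)²)`, with the sup metric. -/
def Torus (m : ℕ) : Type := Fin ((m + 1) ^ 2) → ZMod (4 * (m + 1))

namespace Torus
variable {m : ℕ}

instance : AddCommGroup (Torus m) :=
  inferInstanceAs (AddCommGroup (Fin ((m + 1) ^ 2) → ZMod (4 * (m + 1))))

noncomputable instance : Fintype (Torus m) :=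
  haveI : NeZero (4 * (m + 1)) := ⟨by omega⟩
  inferInstanceAs (Fintype (Fin ((m + 1) ^ 2) → ZMod (4 * (m + 1))))

/-- The sup norm of an element of the torus. -/
def supNorm (x : Torus m) : ℕ := univ.sup fun i => (x i).valMinAbs.natAbs

theorem le_supNorm (x : Torus m) (i : Fin ((m + 1) ^ 2)) :
    (x i).valMinAbs.natAbs ≤ supNorm x :=
  Finset.le_sup (f := fun i => (x i).valMinAbs.natAbs) (mem_univ i)

theorem supNorm_le {x : Torus m} {k : ℕ} : supNorm x ≤ k ↔ ∀ i, (x i).valMinAbs.natAbs ≤ k := by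
  simp [supNorm, Finset.sup_le_iff]

theorem supNorm_zero : supNorm (0 : Torus m) = 0 :=
  Nat.le_zero.1 <| supNorm_le.2 fun i => by
    change (0 : ZMod (4 * (m + 1))).valMinAbs.natAbs ≤ 0
    simp

theorem supNorm_neg (x : Torus m) : supNorm (-x) = supNorm x :=
  Finset.sup_congr rfl fun i _ => ZMod.natAbs_valMinAbs_neg (x i)

theorem supNorm_add_le (x y : Torus m) : supNorm (x + y) ≤ supNorm x + supNorm y :=
  supNorm_le.2 fun i =>
    ((ZMod.natAbs_valMinAbs_add_le (x i) (y i)).trans (Int.natAbs_add_le _ _)).trans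
      (add_le_add (le_supNorm x i) (le_supNorm y i))

theorem eq_zero_of_supNorm_eq_zero {x : Torus m} (h : supNorm x = 0) : x = 0 :=
  funext fun i => (ZMod.valMinAbs_eq_zero _).1 <|
    Int.natAbs_eq_zero.1 <| Nat.le_zero.1 <| h ▸ le_supNorm x i

instance : MetricSpace (Torus m) where
  dist x y := supNorm (x - y)
  dist_self x := by rw [sub_self, supNorm_zero, Nat.cast_zero]
  dist_comm x y := by rw [← supNorm_neg, neg_sub]
  dist_triangle x y z := by
    rw [← sub_add_sub_cancel x y z]
    exact_mod_cast supNorm_add_le _ _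
  eq_of_dist_eq_zero h := sub_eq_zero.1 (eq_zero_of_supNorm_eq_zero (by exact_mod_cast h))

theorem dist_eq (x y : Torus m) : dist x y = supNorm (x - y) := rfl

theorem dist_le (x y : Torus m) : dist x y ≤ 2 * (m + 1) := by
  have : NeZero (4 * (m + 1)) := ⟨by omega⟩
  rw [dist_eq]
  have h : supNorm (x - y) ≤ 2 * (m + 1) := supNorm_le.2 fun i =>
    (ZMod.natAbs_valMinAbs_le _).trans (by omega)
  exact_mod_cast h

/-- The standard generators of the torus. -/
def basisVec (j : Fin ((m + 1) ^ 2)) : Torus m :=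
  (Pi.single j 1 : Fin ((m + 1) ^ 2) → ZMod (4 * (m + 1)))

theorem zsmul_basisVec_apply (k : ℤ) (j i : Fin ((m + 1) ^ 2)) :
    (k • basisVec j : Torus m) i = if i = j then (k : ZMod (4 * (m + 1))) else 0 := by
  change k • (Pi.single j 1 : Fin ((m + 1) ^ 2) → ZMod (4 * (m + 1))) i = _
  rw [Pi.single_apply]
  split_ifs <;> simp

theorem natAbs_valMinAbs_natCast_of_le_half {n k : ℕ} (h : 2 * k ≤ n) :
    ((k : ZMod n)).valMinAbs.natAbs = k := by
  rw [ZMod.valMinAbs_natCast_of_le_half (by omega), Int.natAbs_natCast]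

theorem dist_add_zsmul_basisVec (x : Torus m) (j : Fin ((m + 1) ^ 2)) :
    (2 * (m + 1) : ℝ) ≤ dist (x + (2 * (m + 1 : ℕ) : ℤ) • basisVec j) x := by
  rw [dist_eq, add_sub_cancel_left]
  have h := le_supNorm ((2 * (m + 1 : ℕ) : ℤ) • basisVec j : Torus m) j
  rw [zsmul_basisVec_apply, if_pos rfl] at h
  have h2 : (((2 * (m + 1 : ℕ) : ℤ)) : ZMod (4 * (m + 1))) = ((2 * (m + 1) : ℕ) : ZMod _) := by
    push_cast
    rfl
  rw [h2, natAbs_valMinAbs_natCast_of_le_half (by omega)] at h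
  exact_mod_cast h

theorem dist_add_signedSum (x : Torus m) (ε : Fin ((m + 1) ^ 2) → ℤˣ) :
    dist (x + signedSum basisVec ε) x ≤ 1 := by
  rw [dist_eq, add_sub_cancel_left]
  have h : supNorm (signedSum basisVec ε : Torus m) ≤ 1 := supNorm_le.2 fun i => by
    have : (signedSum basisVec ε : Torus m) i = (((ε i : ℤˣ) : ℤ) : ZMod (4 * (m + 1))) := by
      unfold signedSum
      refine (Finset.sum_apply (M := fun _ => ZMod (4 * (m + 1))) i univ
        fun j => ((ε j : ℤ) • basisVec j : Torus m)).trans ?_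
      simp_rw [zsmul_basisVec_apply]
      simp
    have h1 : (1 : ZMod (4 * (m + 1))).valMinAbs.natAbs = 1 := by
      have := natAbs_valMinAbs_natCast_of_le_half (n := 4 * (m + 1)) (k := 1) (by omega)
      rwa [Nat.cast_one] at this
    rw [this]
    rcases Int.units_eq_one_or (ε i) with h | h
    · rw [h]; simp [h1]
    · rw [h]; simp [h1, ZMod.natAbs_valMinAbs_neg]
  exact_mod_cast h

theorem dist_add_basisVec (x : Torus m) (j : Fin ((m + 1) ^ 2)) :
    dist (x + basisVec j) x ≤ 1 := by
  rw [dist_eq, add_sub_cancel_left]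
  have h : supNorm (basisVec j : Torus m) ≤ 1 := supNorm_le.2 fun i => by
    have h0 := zsmul_basisVec_apply 1 j i
    rw [one_zsmul] at h0
    rw [h0]
    split_ifs
    · have := natAbs_valMinAbs_natCast_of_le_half (n := 4 * (m + 1)) (k := 1) (by omega)
      rw [Nat.cast_one] at this
      rw [Int.cast_one, this]
    · simp
  exact_mod_cast h

end Torus

/-- The coarse disjoint union of the tori `Torus m`. -/
def TorusUnion : Type := Σ m, Torus m

namespace TorusUnion

open Classical in
/-- The distance of the coarse disjoint union: two points of different tori
are at distance twice the larger size. -/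
noncomputable def unionDist (x y : TorusUnion) : ℝ :=
  if h : x.1 = y.1 then dist (h ▸ x.2 : Torus y.1) y.2 else 2 * (max (x.1 : ℝ) y.1 + 1)

theorem unionDist_same {m : ℕ} (x y : Torus m) : unionDist ⟨m, x⟩ ⟨m, y⟩ = dist x y := by
  simp [unionDist]

theorem unionDist_ne {m k : ℕ} (h : m ≠ k) (x : Torus m) (y : Torus k) :
    unionDist ⟨m, x⟩ ⟨k, y⟩ = 2 * (max (m : ℝ) k + 1) := by
  simp [unionDist, h]

noncomputable instance : MetricSpace TorusUnion where
  dist := unionDist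
  dist_self := fun ⟨m, x⟩ => by
    rw [unionDist_same, dist_self]
  dist_comm := fun ⟨m, x⟩ ⟨k, y⟩ => by
    rcases eq_or_ne m k with rfl | h
    · rw [unionDist_same, unionDist_same, dist_comm]
    · rw [unionDist_ne h, unionDist_ne h.symm, max_comm]
  dist_triangle := fun ⟨m, x⟩ ⟨k, y⟩ ⟨l, z⟩ => by
    have hm := le_max_left (m : ℝ) k
    have hk := le_max_right (m : ℝ) k
    have hk' := le_max_left (k : ℝ) l
    have hl := le_max_right (k : ℝ) l
    have hm0 : (0 : ℝ) ≤ m := m.cast_nonneg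
    have hk0 : (0 : ℝ) ≤ k := k.cast_nonneg
    rcases eq_or_ne m k with rfl | hmk
    · rcases eq_or_ne m l with rfl | hml
      · simpa only [unionDist_same] using dist_triangle x y z
      · rw [unionDist_ne hml, unionDist_ne hml, unionDist_same]
        linarith [dist_nonneg (x := x) (y := y)]
    · rw [unionDist_ne hmk]
      rcases eq_or_ne k l with rfl | hkl
      · rw [unionDist_ne hmk, unionDist_same]
        linarith [dist_nonneg (x := y) (y := z)]
      · rw [unionDist_ne hkl]
        rcases eq_or_ne m l with rfl | hml
        · rw [unionDist_same]
          linarith [Torus.dist_le x z]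
        · rw [unionDist_ne hml]
          have : max (m : ℝ) l ≤ max (m : ℝ) k + max (k : ℝ) l :=
            max_le (by linarith) (by linarith)
          linarith
  eq_of_dist_eq_zero := by
    rintro ⟨m, x⟩ ⟨k, y⟩ h
    change unionDist _ _ = _ at h
    rcases eq_or_ne m k with rfl | hmk
    · rw [unionDist_same, dist_eq_zero] at h
      rw [h]
    · rw [unionDist_ne hmk] at h
      have := (m.cast_nonneg (α := ℝ)).trans (le_max_left (m : ℝ) k)
      linarith

theorem dist_mk {m : ℕ} (x y : Torus m) :
    dist (α := TorusUnion) ⟨m, x⟩ ⟨m, y⟩ = dist x y := unionDist_same x y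

theorem fst_le_of_dist_le {x y : TorusUnion} {r : ℝ} (h : dist x y ≤ r) :
    x.1 ≤ max y.1 ⌈r⌉₊ := by
  obtain ⟨m, x⟩ := x
  obtain ⟨k, y⟩ := y
  change unionDist _ _ ≤ r at h
  rcases eq_or_ne m k with rfl | hmk
  · exact le_max_left _ _
  · rw [unionDist_ne hmk] at h
    refine le_max_of_le_right ?_
    have h1 := le_max_left (m : ℝ) k
    have h2 := Nat.le_ceil r
    have h3 : (0 : ℝ) ≤ m := m.cast_nonneg
    have : (m : ℝ) ≤ (⌈r⌉₊ : ℝ) := by linarith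
    exact_mod_cast this

theorem locallyFinite : LocallyFiniteSpace TorusUnion := by
  intro s hs
  rcases s.eq_empty_or_nonempty with rfl | ⟨z, hz⟩
  · exact Set.finite_empty
  obtain ⟨r, hr⟩ := Metric.isBounded_iff.1 hs
  let t : Finset (Σ m, Torus m) := (range (max z.1 ⌈r⌉₊ + 1)).sigma fun _ => univ
  refine t.finite_toSet.subset fun x hx => ?_
  have := fst_le_of_dist_le (hr hx hz)
  exact Finset.mem_coe.2 (Finset.mem_sigma.2 ⟨Finset.mem_range.2 (by omega), mem_univ _⟩)

theorem not_coarseEmbedding_of_isLpSubspace {p : ℝ} (hp : 0 < p) (hp2 : p ≤ 2) {Y : Type*}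
    [MetricSpace Y] (hY : IsLpSubspace p Y) (f : TorusUnion → Y) :
    ¬ IsCoarseEmbeddingWith (distOf TorusUnion) (distOf Y) f := by
  rintro ⟨ρ₁, ρ₂, h1, h2, h, htop⟩
  have hq : 0 < max 1 p := lt_max_of_lt_left one_pos
  obtain ⟨R, hR⟩ := Filter.eventually_atTop.1
    (((tendsto_rpow_atTop hq).comp htop).eventually_gt_atTop (48 * ρ₂ 1 ^ max 1 p))
  obtain ⟨R', hR'⟩ := Filter.eventually_atTop.1 (htop.eventually_ge_atTop 0)
  set m := ⌈max R R'⌉₊ with hm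
  have hle : max R R' ≤ 2 * (m + 1) := by
    have := Nat.le_ceil (max R R')
    rw [← hm] at this
    have h3 : (0 : ℝ) ≤ m := m.cast_nonneg
    linarith
  have key := (hY.cotypeInequality hp hp2 (Torus.basisVec (m := m)) (m + 1)
    fun x => f ⟨m, x⟩).le_of_card_eq m.succ_ne_zero (Fintype.card_fin _)
    (A := ρ₁ (2 * (m + 1)) ^ max 1 p) (B := ρ₂ 1 ^ max 1 p) ?_ ?_
  · exact absurd key (not_le.2 (hR _ ((le_max_left _ _).trans hle)))
  · intro j x
    refine Real.rpow_le_rpow (hR' _ ((le_max_right _ _).trans hle)) ?_ hq.le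
    exact (h1 ((Torus.dist_add_zsmul_basisVec x j).trans_eq (dist_mk _ _).symm)).trans
      (h _ _).1
  · intro ε x
    refine Real.rpow_le_rpow dist_nonneg ?_ hq.le
    exact (h ⟨m, _⟩ ⟨m, x⟩).2.trans
      (h2 ((dist_mk _ _).trans_le (Torus.dist_add_signedSum x ε)))

theorem not_coarseEmbedding_of_isUltrametricSpace {Y : Type*} [MetricSpace Y]
    (hY : IsUltrametricSpace Y) (f : TorusUnion → Y) :
    ¬ IsCoarseEmbeddingWith (distOf TorusUnion) (distOf Y) f := by
  rintro ⟨ρ₁, ρ₂, h1, h2, h, htop⟩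
  obtain ⟨R, hR⟩ := Filter.eventually_atTop.1 (htop.eventually_gt_atTop (ρ₂ 1))
  set m := ⌈R⌉₊ with hm
  have hle : R ≤ 2 * (m + 1) := by
    have := Nat.le_ceil R
    rw [← hm] at this
    have h3 : (0 : ℝ) ≤ m := m.cast_nonneg
    linarith
  let j : Fin ((m + 1) ^ 2) := ⟨0, by positivity⟩
  have hstep : ∀ x : Torus m, dist (f ⟨m, x + Torus.basisVec j⟩) (f ⟨m, x⟩) ≤ ρ₂ 1 := fun x =>
    (h ⟨m, _⟩ ⟨m, x⟩).2.trans (h2 ((dist_mk _ _).trans_le (Torus.dist_add_basisVec x j)))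
  have hall : ∀ k : ℕ, dist (f ⟨m, 0 + (k : ℤ) • Torus.basisVec j⟩) (f ⟨m, 0⟩) ≤ ρ₂ 1 := by
    intro k
    induction k with
    | zero =>
      simp only [Nat.cast_zero, zero_smul, add_zero, dist_self]
      exact dist_nonneg.trans (hstep 0)
    | succ k ih =>
      refine (hY _ (f ⟨m, 0 + (k : ℤ) • Torus.basisVec j⟩) _).trans (max_le ?_ ih)
      rw [Nat.cast_succ, add_smul, one_smul, ← add_assoc]
      exact hstep _
  have hlow := (h1 ((Torus.dist_add_zsmul_basisVec (0 : Torus m) j).trans_eq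
    (dist_mk _ _).symm)).trans (h _ _).1
  have hup := hall (2 * (m + 1))
  rw [Nat.cast_mul, Nat.cast_two] at hup
  exact absurd (hlow.trans hup) (not_le.2 (hR _ hle))

end TorusUnion

end Torus

/-- Corollary 1 of the paper: for `0 < p ≤ 2` no metric subspace of an
`L_p(μ)`-space is a universal coarse embedding space, and no ultrametric space is a
universal coarse embedding space: there is a locally finite metric space that does not
coarsely embed into any such space. -/
theorem Lp_subspaces_and_ultrametric_not_universal :
    ∃ (Z : Type) (iZ : MetricSpace Z), @LocallyFiniteSpace Z iZ ∧
      (∀ p : ℝ, 0 < p → p ≤ 2 → ∀ (Y : Type) (iY : MetricSpace Y),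
        @IsLpSubspace p Y iY →
          ¬∃ f : Z → Y, IsCoarseEmbeddingWith (@distOf Z iZ) (@distOf Y iY) f) ∧
      (∀ (Y : Type) (iY : MetricSpace Y), @IsUltrametricSpace Y iY →
          ¬∃ f : Z → Y, IsCoarseEmbeddingWith (@distOf Z iZ) (@distOf Y iY) f) := by
  exact ⟨TorusUnion, inferInstance, TorusUnion.locallyFinite,
    fun _ hp hp2 _ _ hY ⟨f, hf⟩ =>
      TorusUnion.not_coarseEmbedding_of_isLpSubspace hp hp2 hY f hf,
    fun _ _ hY ⟨f, hf⟩ => TorusUnion.not_coarseEmbedding_of_isUltrametricSpace hY f hf⟩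
end

section
/- Let G be an abelian group with a symmetric generating set Σ (so −Σ = Σ, 0 ∉ Σ), and suppose there exist g, h ∈ Σ with g ≠ h, g + h ≠ 0, g + h ∉ Σ and g − h ∉ Σ. Then the Cayley graph Γ = Cay(G,Σ), endowed with the word metric, has generalized roundness 𝔮(Γ) ≤ 1. -/
/-- The word metric on an (additive) group `G` with respect to a generating set `S`:
`wordDist S a b` is the least `k` such that `b − a` is a sum of `k` elements of `S`. -/
noncomputable def wordDist {G : Type*} [AddCommGroup G] (S : Set G) (a b : G) : ℕ :=
  sInf {k : ℕ | ∃ w : Fin k → G, (∀ i, w i ∈ S) ∧ ∑ i, w i = b - a}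

/-- `S` is a symmetric generating set of the (additive) group `G`:
`−S = S`, `0 ∉ S`, and every element of `G` is a sum of elements of `S`. -/
def IsSymmGenSet {G : Type*} [AddCommGroup G] (S : Set G) : Prop :=
  (∀ s ∈ S, -s ∈ S) ∧ (0 : G) ∉ S ∧
    ∀ x : G, ∃ (k : ℕ) (w : Fin k → G), (∀ i, w i ∈ S) ∧ ∑ i, w i = x

theorem wordDist_eq_one {G : Type*} [AddCommGroup G] {S : Set G} (h0 : (0 : G) ∉ S) {a b : G}
    (hab : b - a ∈ S) : wordDist S a b = 1 := by
  refine le_antisymm (Nat.sInf_le ⟨fun _ => b - a, fun _ => hab, by simp⟩) ?_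
  refine le_csInf ⟨1, fun _ => b - a, fun _ => hab, by simp⟩ ?_
  rintro k ⟨w, -, hw⟩
  by_contra hk
  obtain rfl : k = 0 := by omega
  exact h0 (by simpa [← hw] using hab)

theorem wordDist_eq_two {G : Type*} [AddCommGroup G] {S : Set G} {a b s t : G}
    (hs : s ∈ S) (ht : t ∈ S) (hst : s + t = b - a) (hne : b - a ≠ 0) (hab : b - a ∉ S) :
    wordDist S a b = 2 := by
  have hmem : 2 ∈ {k : ℕ | ∃ w : Fin k → G, (∀ i, w i ∈ S) ∧ ∑ i, w i = b - a} :=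
    ⟨![s, t], by simp [Fin.forall_fin_two, hs, ht], by simp [Fin.sum_univ_two, hst]⟩
  refine le_antisymm (Nat.sInf_le hmem) (le_csInf ⟨2, hmem⟩ ?_)
  rintro k ⟨w, hwS, hw⟩
  by_contra hk
  obtain rfl | rfl : k = 0 ∨ k = 1 := by omega
  · exact hne (by simpa using hw.symm)
  · exact hab (by simpa [← hw] using hwS 0)

/-- let `G` be an abelian group with a symmetric generating set `Σ`,
and suppose there are `g, h ∈ Σ` with `g ≠ h`, `g + h ≠ 0`, `g + h ∉ Σ` and
`g − h ∉ Σ`.  Then the Cayley graph `Cay(G,Σ)`, with the word metric, has generalized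
roundness at most `1`. -/
theorem cayley_graph_roundness_le_one {G : Type*} [AddCommGroup G] (S : Set G)
    (hS : IsSymmGenSet S) (g h : G) (hg : g ∈ S) (hh : h ∈ S) (hgh : g ≠ h)
    (hgh0 : g + h ≠ 0) (hghS : g + h ∉ S) (hgmhS : g - h ∉ S) :
    genRoundness (fun a b : G => (wordDist S a b : ℝ)) ≤ 1 := by
  obtain ⟨hneg, h0, -⟩ := hS
  refine sSup_le ?_
  rintro _ ⟨p, ⟨-, hp⟩, rfl⟩
  have key := hp 2 le_rfl ![0, g + h] ![g, h]
  have d1 : wordDist S 0 (g + h) = 2 :=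
    wordDist_eq_two hg hh (by simp) (by simpa using hgh0) (by simpa using hghS)
  have d2 : wordDist S g h = 2 :=
    wordDist_eq_two hh (hneg g hg) (by abel) (sub_ne_zero.mpr hgh.symm)
      fun hmem => hgmhS (by simpa using hneg _ hmem)
  have d3 : wordDist S 0 g = 1 := wordDist_eq_one h0 (by simpa using hg)
  have d4 : wordDist S 0 h = 1 := wordDist_eq_one h0 (by simpa using hh)
  have d5 : wordDist S (g + h) g = 1 := wordDist_eq_one h0 (by simpa using hneg h hh)
  have d6 : wordDist S (g + h) h = 1 := wordDist_eq_one h0 (by simpa using hneg g hg)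
  simp [Fin.sum_univ_two, d1, d2, d3, d4, d5, d6] at key
  have hpow : (2 : ℝ) ^ p ≤ 2 ^ (1 : ℝ) := by
    rw [Real.rpow_one]
    linarith
  exact ENNReal.ofReal_le_one.mpr ((Real.rpow_le_rpow_left_iff one_lt_two).mp hpow)
end
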